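/- Let (f̊, λ̊, μ̊, e̊) be initial data for the spherically symmetric Einstein–Vlasov–Maxwell system: f̊ ≥ 0 is C^∞, compactly supported and spherically symmetric on ℝ³×ℝ³, satisfies 8π∫₀^r s²(∫_{ℝ³} f̊(s,v)√(1+|v|²) dv) ds < r for all r > 0, and (λ̊, μ̊, e̊) is a regular solution of the constraint equations with data f̊. Let (f, λ, μ, e) be a regular solution of the corresponding initial–boundary value problem on [0,T)×ℝ³×ℝ³ with T < ∞, and suppose there exists ε > 0 such that f(t, x̃, v) = 0 whenever 0 ≤ t < T and |x̃| ≤ ε. Then the quantity P(t) := sup{ |v| : (x̃,v) ∈ supp f(t) } is bounded on [0,T). -/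

import Mathlib

open MeasureTheory Real Set Function Filter
open scoped RealInnerProductSpace

noncomputable section

/-- Euclidean 3-space. -/
abbrev E3 : Type := EuclideanSpace ℝ (Fin 3)

/-- Energy density `ρ(t,x) = ∫ f √(1+|v|²) dv + ½ e^{2λ} e²`. -/
def rhoEVM (f : ℝ → E3 → E3 → ℝ) (lam el : ℝ → ℝ → ℝ) (t : ℝ) (x : E3) : ℝ :=
  (∫ (v : E3), Real.sqrt (1 + ‖v‖ ^ 2) * f t x v)
    + (1 / 2) * Real.exp (2 * lam t ‖x‖) * (el t ‖x‖) ^ 2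

/-- Radial momentum density `k(t,x) = ∫ ((x·v)/r) f dv`. -/
def kEVM (f : ℝ → E3 → E3 → ℝ) (t : ℝ) (x : E3) : ℝ :=
  ∫ (v : E3), (⟪x, v⟫ / ‖x‖) * f t x v

/-- Radial pressure `p(t,x) = ∫ ((x·v)/r)² f dv/√(1+|v|²) − ½ e^{2λ} e²`. -/
def pEVM (f : ℝ → E3 → E3 → ℝ) (lam el : ℝ → ℝ → ℝ) (t : ℝ) (x : E3) : ℝ :=
  (∫ (v : E3), (⟪x, v⟫ / ‖x‖) ^ 2 * f t x v / Real.sqrt (1 + ‖v‖ ^ 2))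
    - (1 / 2) * Real.exp (2 * lam t ‖x‖) * (el t ‖x‖) ^ 2

/-- Charge density `M(t,x) = ∫ f dv`. -/
def MEVM (f : ℝ → E3 → E3 → ℝ) (t : ℝ) (x : E3) : ℝ := ∫ (v : E3), f t x v

/-- Current density `N(t,x) = ∫ ((x·v)/√(1+|v|²)) f dv`. -/
def NEVM (f : ℝ → E3 → E3 → ℝ) (t : ℝ) (x : E3) : ℝ :=
  ∫ (v : E3), (⟪x, v⟫ / Real.sqrt (1 + ‖v‖ ^ 2)) * f t x v

/-- A function on phase space `ℝ³ × ℝ³` is spherically symmetric if it is invariant under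
simultaneous rotations (elements of SO(3)) of `x` and `v`. -/
def SphericallySymmetric (g : E3 → E3 → ℝ) : Prop :=
  ∀ A ∈ Matrix.orthogonalGroup (Fin 3) ℝ, A.det = 1 →
    ∀ x v : E3, g (Matrix.toEuclideanLin A x) (Matrix.toEuclideanLin A v) = g x v

/-- A regular solution `(f, λ, μ, e)` of the spherically symmetric
Einstein–Vlasov–Maxwell system with particle charge `q` on the time interval `[0, T)`,
with the boundary conditions `λ(t,0) = e(t,0) = 0` and `λ, μ, e → 0` as `r → ∞`. -/
structure IsRegularSolutionEVM (q T : ℝ) (f : ℝ → E3 → E3 → ℝ)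
    (lam mu el : ℝ → ℝ → ℝ) : Prop where
  /-- `f` is nonnegative. -/
  f_nonneg : ∀ t ∈ Ico (0 : ℝ) T, ∀ x v : E3, 0 ≤ f t x v
  /-- `f(t)` is spherically symmetric. -/
  f_symm : ∀ t ∈ Ico (0 : ℝ) T, SphericallySymmetric (f t)
  /-- `f` is `C¹`. -/
  f_c1 : ContDiffOn ℝ 1 (fun p : ℝ × E3 × E3 => f p.1 p.2.1 p.2.2)
    ((Ico (0 : ℝ) T) ×ˢ (univ : Set (E3 × E3)))
  /-- `f(t)` has compact support for each `t`. -/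
  f_cpt : ∀ t ∈ Ico (0 : ℝ) T, HasCompactSupport (fun p : E3 × E3 => f t p.1 p.2)
  /-- `λ` is `C¹`. -/
  lam_c1 : ContDiffOn ℝ 1 (fun p : ℝ × ℝ => lam p.1 p.2)
    ((Ico (0 : ℝ) T) ×ˢ (univ : Set ℝ))
  /-- `μ` is `C¹`. -/
  mu_c1 : ContDiffOn ℝ 1 (fun p : ℝ × ℝ => mu p.1 p.2)
    ((Ico (0 : ℝ) T) ×ˢ (univ : Set ℝ))
  /-- `λ' = ∂_r λ` is `C¹`. -/
  lam'_c1 : ContDiffOn ℝ 1 (fun p : ℝ × ℝ => deriv (lam p.1) p.2)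
    ((Ico (0 : ℝ) T) ×ˢ (univ : Set ℝ))
  /-- `μ' = ∂_r μ` is `C¹`. -/
  mu'_c1 : ContDiffOn ℝ 1 (fun p : ℝ × ℝ => deriv (mu p.1) p.2)
    ((Ico (0 : ℝ) T) ×ˢ (univ : Set ℝ))
  /-- `e` is continuous. -/
  el_cont : ContinuousOn (fun p : ℝ × ℝ => el p.1 p.2)
    ((Ico (0 : ℝ) T) ×ˢ (univ : Set ℝ))
  /-- `e' = ∂_r e` is continuous. -/
  el'_cont : ContinuousOn (fun p : ℝ × ℝ => deriv (el p.1) p.2)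
    ((Ico (0 : ℝ) T) ×ˢ (univ : Set ℝ))
  /-- First Einstein equation: `e^{−2λ}(2rλ′−1)+1 = 8πr²ρ`. -/
  einstein_lam : ∀ t ∈ Ico (0 : ℝ) T, ∀ x : E3, x ≠ 0 →
    Real.exp (-2 * lam t ‖x‖) * (2 * ‖x‖ * deriv (lam t) ‖x‖ - 1) + 1
      = 8 * π * ‖x‖ ^ 2 * rhoEVM f lam el t x
  /-- Second Einstein equation: `λ̇ = −4πr e^{λ+μ} k`. -/
  einstein_lamdot : ∀ t ∈ Ico (0 : ℝ) T, ∀ x : E3, x ≠ 0 →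
    deriv (fun s => lam s ‖x‖) t
      = -(4 * π) * ‖x‖ * Real.exp (lam t ‖x‖ + mu t ‖x‖) * kEVM f t x
  /-- Third Einstein equation: `e^{−2λ}(2rμ′+1)−1 = 8πr²p`. -/
  einstein_mu : ∀ t ∈ Ico (0 : ℝ) T, ∀ x : E3, x ≠ 0 →
    Real.exp (-2 * lam t ‖x‖) * (2 * ‖x‖ * deriv (mu t) ‖x‖ + 1) - 1
      = 8 * π * ‖x‖ ^ 2 * pEVM f lam el t x
  /-- The Vlasov equation, written as the vanishing of the derivative of `f` in the
  direction of the characteristic vector field. -/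
  vlasov : ∀ t ∈ Ico (0 : ℝ) T, ∀ x : E3, x ≠ 0 → ∀ v : E3,
    fderiv ℝ (fun p : ℝ × E3 × E3 => f p.1 p.2.1 p.2.2) (t, x, v)
      (1, (Real.exp (mu t ‖x‖ - lam t ‖x‖) / Real.sqrt (1 + ‖v‖ ^ 2)) • v,
        -((Real.exp (mu t ‖x‖ - lam t ‖x‖) * deriv (mu t) ‖x‖ * Real.sqrt (1 + ‖v‖ ^ 2)
            + deriv (fun s => lam s ‖x‖) t * (⟪x, v⟫ / ‖x‖)
            - q * Real.exp (lam t ‖x‖ + mu t ‖x‖) * el t ‖x‖) / ‖x‖) • x) = 0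
  /-- First Maxwell equation: `∂_r(r²e^{λ}e) = q r² e^{λ} M`. -/
  maxwell_r : ∀ t ∈ Ico (0 : ℝ) T, ∀ x : E3, x ≠ 0 →
    deriv (fun r => r ^ 2 * Real.exp (lam t r) * el t r) ‖x‖
      = q * ‖x‖ ^ 2 * Real.exp (lam t ‖x‖) * MEVM f t x
  /-- Second Maxwell equation: `∂_t(e^{λ}e) = −(q/r) e^{μ} N`. -/
  maxwell_t : ∀ t ∈ Ico (0 : ℝ) T, ∀ x : E3, x ≠ 0 →
    deriv (fun s => Real.exp (lam s ‖x‖) * el s ‖x‖) t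
      = -(q / ‖x‖) * Real.exp (mu t ‖x‖) * NEVM f t x
  /-- Boundary condition at the center: `λ(t,0) = 0`. -/
  bc_lam_center : ∀ t ∈ Ico (0 : ℝ) T, lam t 0 = 0
  /-- Boundary condition at the center: `e(t,0) = 0`. -/
  bc_el_center : ∀ t ∈ Ico (0 : ℝ) T, el t 0 = 0
  /-- `λ(t,r) → 0` as `r → ∞`. -/
  bc_lam_infty : ∀ t ∈ Ico (0 : ℝ) T, Tendsto (lam t) atTop (nhds 0)
  /-- `μ(t,r) → 0` as `r → ∞`. -/
  bc_mu_infty : ∀ t ∈ Ico (0 : ℝ) T, Tendsto (mu t) atTop (nhds 0)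
  /-- `e(t,r) → 0` as `r → ∞`. -/
  bc_el_infty : ∀ t ∈ Ico (0 : ℝ) T, Tendsto (el t) atTop (nhds 0)

/-- Admissible initial datum `f̊`: nonnegative, `C^∞`, compactly supported and
spherically symmetric. -/
structure IsInitialDatum (f0 : E3 → E3 → ℝ) : Prop where
  nonneg : ∀ x v : E3, 0 ≤ f0 x v
  smooth : ContDiff ℝ (⊤ : ℕ∞) (fun p : E3 × E3 => f0 p.1 p.2)
  cpt : HasCompactSupport (fun p : E3 × E3 => f0 p.1 p.2)
  symm : SphericallySymmetric f0

/-- The smallness condition `8π ∫₀^r s² (∫ f̊(s,v) √(1+v²) dv) ds < r` for all `r > 0`,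
where by spherical symmetry `f̊(s,v)` is evaluated at the radial point of radius `s`. -/
def InitialMassCondition (f0 : E3 → E3 → ℝ) : Prop :=
  ∀ r : ℝ, 0 < r →
    8 * π * ∫ s in (0 : ℝ)..r,
      s ^ 2 * ∫ (v : E3), Real.sqrt (1 + ‖v‖ ^ 2) * f0 (EuclideanSpace.single (0 : Fin 3) s) v
    < r

/-- `(λ̊, μ̊, e̊)` is a regular solution of the constraint equations with data `f̊`:
the equations for `λ′`, `μ′` and `∂_r(r² e^{λ} e)` at `t = 0`, with sources computed
from `f̊`, together with the regularity and boundary conditions at `t = 0`. -/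
structure IsConstraintSolution (q : ℝ) (f0 : E3 → E3 → ℝ)
    (lam0 mu0 el0 : ℝ → ℝ) : Prop where
  lam0_c1 : ContDiff ℝ 1 lam0
  mu0_c1 : ContDiff ℝ 1 mu0
  lam0'_c1 : ContDiff ℝ 1 (deriv lam0)
  mu0'_c1 : ContDiff ℝ 1 (deriv mu0)
  el0_cont : Continuous el0
  el0'_cont : Continuous (deriv el0)
  lam0_center : lam0 0 = 0
  el0_center : el0 0 = 0
  constraint_lam : ∀ x : E3, x ≠ 0 →
    Real.exp (-2 * lam0 ‖x‖) * (2 * ‖x‖ * deriv lam0 ‖x‖ - 1) + 1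
      = 8 * π * ‖x‖ ^ 2 * rhoEVM (fun _ => f0) (fun _ => lam0) (fun _ => el0) 0 x
  constraint_mu : ∀ x : E3, x ≠ 0 →
    Real.exp (-2 * lam0 ‖x‖) * (2 * ‖x‖ * deriv mu0 ‖x‖ + 1) - 1
      = 8 * π * ‖x‖ ^ 2 * pEVM (fun _ => f0) (fun _ => lam0) (fun _ => el0) 0 x
  constraint_el : ∀ x : E3, x ≠ 0 →
    deriv (fun r => r ^ 2 * Real.exp (lam0 r) * el0 r) ‖x‖
      = q * ‖x‖ ^ 2 * Real.exp (lam0 ‖x‖) * MEVM (fun _ => f0) 0 x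

/-- The solution takes the prescribed initial data at `t = 0`. -/
def TakesInitialData (f : ℝ → E3 → E3 → ℝ) (lam mu el : ℝ → ℝ → ℝ)
    (f0 : E3 → E3 → ℝ) (lam0 mu0 el0 : ℝ → ℝ) : Prop :=
  (∀ x v : E3, f 0 x v = f0 x v) ∧
    (∀ r : ℝ, lam 0 r = lam0 r ∧ mu 0 r = mu0 r ∧ el 0 r = el0 r)


/-! ### Basic moments -/

/-- radial point -/
def e0 (r : ℝ) : E3 := EuclideanSpace.single (0 : Fin 3) r

lemma norm_e0 {r : ℝ} (hr : 0 < r) : ‖e0 r‖ = r := by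
  simp [e0, abs_of_pos hr]

lemma e0_ne {r : ℝ} (hr : 0 < r) : e0 r ≠ 0 := by
  intro h
  have := norm_e0 hr
  rw [h, norm_zero] at this
  exact hr.ne this

lemma e0_eq (r : ℝ) : e0 r = r • e0 1 := by
  ext i
  simp [e0, PiLp.single_apply]

/-- matter energy density at radius `r` -/
def rm (f : ℝ → E3 → E3 → ℝ) (t r : ℝ) : ℝ := ∫ (v : E3), Real.sqrt (1 + ‖v‖ ^ 2) * f t (e0 r) v

/-- matter pressure at radius `r` -/
def pm (f : ℝ → E3 → E3 → ℝ) (t r : ℝ) : ℝ :=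
  ∫ (v : E3), (⟪e0 r, v⟫ / ‖e0 r‖) ^ 2 * f t (e0 r) v / Real.sqrt (1 + ‖v‖ ^ 2)

lemma sqrt1_pos (v : E3) : 0 < Real.sqrt (1 + ‖v‖ ^ 2) := Real.sqrt_pos.2 (by positivity)

lemma one_le_sqrt1 (v : E3) : 1 ≤ Real.sqrt (1 + ‖v‖ ^ 2) :=
  Real.one_le_sqrt.2 (by nlinarith [sq_nonneg ‖v‖])

lemma sq_sqrt1 (v : E3) : Real.sqrt (1 + ‖v‖ ^ 2) ^ 2 = 1 + ‖v‖ ^ 2 := Real.sq_sqrt (by positivity)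

lemma norm_le_sqrt1 (v : E3) : ‖v‖ ≤ Real.sqrt (1 + ‖v‖ ^ 2) :=
  Real.le_sqrt_of_sq_le (by linarith)

lemma abs_w_le (x v : E3) : |⟪x, v⟫ / ‖x‖| ≤ ‖v‖ := by
  rcases eq_or_ne x 0 with rfl | hx
  · simp
  have hx' : 0 < ‖x‖ := norm_pos_iff.2 hx
  rw [abs_div, abs_of_pos hx', div_le_iff₀ hx', mul_comm]
  exact abs_real_inner_le_norm x v

lemma sq_w_le (x v : E3) : (⟪x, v⟫ / ‖x‖) ^ 2 ≤ ‖v‖ ^ 2 := by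
  have := abs_w_le x v
  rw [← sq_abs]
  gcongr

section fixedtime

variable {q T : ℝ} {f : ℝ → E3 → E3 → ℝ} {lam mu el : ℝ → ℝ → ℝ}

lemma f_contDiff (hsol : IsRegularSolutionEVM q T f lam mu el) {t : ℝ} (ht : t ∈ Ico (0:ℝ) T) :
    ContDiff ℝ 1 (fun p : E3 × E3 => f t p.1 p.2) := by
  have h := hsol.f_c1.comp_contDiff (g := fun p : ℝ × E3 × E3 => f p.1 p.2.1 p.2.2)
    (f := fun p : E3 × E3 => (t, p)) (by fun_prop) (fun p => ⟨ht, mem_univ _⟩)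
  exact h

lemma lam_contDiff (hsol : IsRegularSolutionEVM q T f lam mu el) {t : ℝ} (ht : t ∈ Ico (0:ℝ) T) :
    ContDiff ℝ 1 (lam t) :=
  hsol.lam_c1.comp_contDiff (f := fun r : ℝ => (t, r)) (by fun_prop) (fun p => ⟨ht, mem_univ _⟩)

lemma mu_contDiff (hsol : IsRegularSolutionEVM q T f lam mu el) {t : ℝ} (ht : t ∈ Ico (0:ℝ) T) :
    ContDiff ℝ 1 (mu t) :=
  hsol.mu_c1.comp_contDiff (f := fun r : ℝ => (t, r)) (by fun_prop) (fun p => ⟨ht, mem_univ _⟩)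

lemma lam'_contDiff (hsol : IsRegularSolutionEVM q T f lam mu el) {t : ℝ} (ht : t ∈ Ico (0:ℝ) T) :
    ContDiff ℝ 1 (deriv (lam t)) :=
  hsol.lam'_c1.comp_contDiff (f := fun r : ℝ => (t, r)) (by fun_prop) (fun p => ⟨ht, mem_univ _⟩)

lemma el_continuous (hsol : IsRegularSolutionEVM q T f lam mu el) {t : ℝ} (ht : t ∈ Ico (0:ℝ) T) :
    Continuous (el t) :=
  hsol.el_cont.comp_continuous (f := fun r : ℝ => (t, r)) (by fun_prop) (fun p => ⟨ht, mem_univ _⟩)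

lemma fv_continuous (hsol : IsRegularSolutionEVM q T f lam mu el) {t : ℝ} (ht : t ∈ Ico (0:ℝ) T)
    (x : E3) : Continuous (fun v => f t x v) :=
  (f_contDiff hsol ht).continuous.comp (by fun_prop : Continuous fun v : E3 => (x, v))

lemma fv_cpt (hsol : IsRegularSolutionEVM q T f lam mu el) {t : ℝ} (ht : t ∈ Ico (0:ℝ) T)
    (x : E3) : HasCompactSupport (fun v => f t x v) := by
  have hK := hsol.f_cpt t ht
  refine HasCompactSupport.intro (hK.isCompact.image continuous_snd) ?_
  intro v hv
  by_contra h
  exact hv ⟨(x, v), subset_tsupport _ h, rfl⟩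

lemma fv_int (hsol : IsRegularSolutionEVM q T f lam mu el) {t : ℝ} (ht : t ∈ Ico (0:ℝ) T)
    (x : E3) {a : E3 → ℝ} (ha : Continuous a) : Integrable (fun v => a v * f t x v) :=
  (ha.mul (fv_continuous hsol ht x)).integrable_of_hasCompactSupport (fv_cpt hsol ht x).mul_left

lemma fv_mono (hsol : IsRegularSolutionEVM q T f lam mu el) {t : ℝ} (ht : t ∈ Ico (0:ℝ) T)
    (x : E3) {a b : E3 → ℝ} (ha : Continuous a) (hb : Continuous b) (hab : ∀ v, a v ≤ b v) :
    ∫ v, a v * f t x v ≤ ∫ v, b v * f t x v :=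
  integral_mono (fv_int hsol ht x ha) (fv_int hsol ht x hb)
    (fun v => mul_le_mul_of_nonneg_right (hab v) (hsol.f_nonneg t ht x v))

lemma cont_sqrt1 : Continuous fun v : E3 => Real.sqrt (1 + ‖v‖ ^ 2) := by fun_prop

lemma cont_w (x : E3) : Continuous fun v : E3 => ⟪x, v⟫ / ‖x‖ := by fun_prop

lemma cont_w2 (x : E3) : Continuous fun v : E3 => (⟪x, v⟫ / ‖x‖) ^ 2 / Real.sqrt (1 + ‖v‖ ^ 2) :=
  ((cont_w x).pow 2).div cont_sqrt1 (fun v => (sqrt1_pos v).ne')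

lemma pm_eq (f : ℝ → E3 → E3 → ℝ) (t r : ℝ) : pm f t r =
    ∫ v, ((⟪e0 r, v⟫ / ‖e0 r‖) ^ 2 / Real.sqrt (1 + ‖v‖ ^ 2)) * f t (e0 r) v := by
  unfold pm
  congr 1
  ext v
  ring

lemma rm_nonneg (hsol : IsRegularSolutionEVM q T f lam mu el) {t : ℝ} (ht : t ∈ Ico (0:ℝ) T)
    (r : ℝ) : 0 ≤ rm f t r :=
  integral_nonneg fun v => mul_nonneg (sqrt1_pos v).le (hsol.f_nonneg t ht _ v)

lemma pm_nonneg (hsol : IsRegularSolutionEVM q T f lam mu el) {t : ℝ} (ht : t ∈ Ico (0:ℝ) T)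
    (r : ℝ) : 0 ≤ pm f t r :=
  integral_nonneg fun v => div_nonneg (mul_nonneg (sq_nonneg _) (hsol.f_nonneg t ht _ v))
    (sqrt1_pos v).le

lemma pm_le_rm (hsol : IsRegularSolutionEVM q T f lam mu el) {t : ℝ} (ht : t ∈ Ico (0:ℝ) T)
    (r : ℝ) : pm f t r ≤ rm f t r := by
  rw [pm_eq]
  refine fv_mono hsol ht _ (cont_w2 _) cont_sqrt1 (fun v => ?_)
  rw [div_le_iff₀ (sqrt1_pos v), ← sq, sq_sqrt1]
  have := sq_w_le (e0 r) v
  linarith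

lemma M_nonneg (hsol : IsRegularSolutionEVM q T f lam mu el) {t : ℝ} (ht : t ∈ Ico (0:ℝ) T)
    (x : E3) : 0 ≤ MEVM f t x :=
  integral_nonneg fun v => hsol.f_nonneg t ht _ v

lemma M_le_rm (hsol : IsRegularSolutionEVM q T f lam mu el) {t : ℝ} (ht : t ∈ Ico (0:ℝ) T)
    (r : ℝ) : MEVM f t (e0 r) ≤ rm f t r := by
  have := fv_mono hsol ht (e0 r) (continuous_const (y := (1:ℝ))) cont_sqrt1 one_le_sqrt1
  simpa [MEVM, rm] using this

lemma abs_k_le (hsol : IsRegularSolutionEVM q T f lam mu el) {t : ℝ} (ht : t ∈ Ico (0:ℝ) T)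
    (r : ℝ) : |kEVM f t (e0 r)| ≤ rm f t r := by
  rw [abs_le]
  have h1 := fun v => (abs_le.1 (abs_w_le (e0 r) v))
  have h2 := norm_le_sqrt1
  constructor
  · have := fv_mono hsol ht (e0 r) cont_sqrt1.neg (cont_w (e0 r))
      (fun v => (neg_le_neg (h2 v)).trans (h1 v).1)
    simp only [Pi.neg_apply, neg_mul, integral_neg] at this
    exact this
  · exact fv_mono hsol ht (e0 r) (cont_w _) cont_sqrt1 (fun v => by linarith [(h1 v).2, h2 v])

/-- `λ' ` equation in solved form. -/
lemma lam_eq (hsol : IsRegularSolutionEVM q T f lam mu el) {t : ℝ} (ht : t ∈ Ico (0:ℝ) T)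
    {r : ℝ} (hr : 0 < r) :
    Real.exp (-2 * lam t r) * deriv (lam t) r
      = 4 * π * r * (rm f t r + 1 / 2 * Real.exp (2 * lam t r) * el t r ^ 2)
        - (1 - Real.exp (-2 * lam t r)) / (2 * r) := by
  have h := hsol.einstein_lam t ht (e0 r) (e0_ne hr)
  rw [rhoEVM, norm_e0 hr] at h
  change _ = 8 * π * r ^ 2 * (rm f t r + _) at h
  generalize Real.exp (-2 * lam t r) = E2 at *
  field_simp
  linarith

lemma mu_eq (hsol : IsRegularSolutionEVM q T f lam mu el) {t : ℝ} (ht : t ∈ Ico (0:ℝ) T)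
    {r : ℝ} (hr : 0 < r) :
    Real.exp (-2 * lam t r) * deriv (mu t) r
      = 4 * π * r * (pm f t r - 1 / 2 * Real.exp (2 * lam t r) * el t r ^ 2)
        + (1 - Real.exp (-2 * lam t r)) / (2 * r) := by
  have h := hsol.einstein_mu t ht (e0 r) (e0_ne hr)
  rw [pEVM] at h
  change _ = 8 * π * _ ^ 2 * (pm f t r - _) at h
  rw [norm_e0 hr] at h
  generalize Real.exp (-2 * lam t r) = E2 at *
  field_simp
  linarith

/-- `u = 2m = r (1 - e^{-2λ})` -/
lemma u_deriv (hsol : IsRegularSolutionEVM q T f lam mu el) {t : ℝ} (ht : t ∈ Ico (0:ℝ) T)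
    {r : ℝ} (hr : 0 < r) :
    HasDerivAt (fun r => r * (1 - Real.exp (-2 * lam t r)))
      (8 * π * r ^ 2 * (rm f t r + 1 / 2 * Real.exp (2 * lam t r) * el t r ^ 2)) r := by
  have hl : HasDerivAt (lam t) (deriv (lam t) r) r :=
    ((lam_contDiff hsol ht).differentiable one_ne_zero r).hasDerivAt
  have h := (hasDerivAt_id r).mul (((hl.const_mul (-2)).exp).const_sub 1)
  refine h.congr_deriv ?_
  have := lam_eq hsol ht hr
  simp only [id]
  generalize Real.exp (-2 * lam t r) = E2 at *
  field_simp at this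
  linarith

lemma u_cont (hsol : IsRegularSolutionEVM q T f lam mu el) {t : ℝ} (ht : t ∈ Ico (0:ℝ) T) :
    Continuous (fun r => r * (1 - Real.exp (-2 * lam t r))) := by
  have := (lam_contDiff hsol ht).continuous
  fun_prop

lemma u_mono (hsol : IsRegularSolutionEVM q T f lam mu el) {t : ℝ} (ht : t ∈ Ico (0:ℝ) T) :
    MonotoneOn (fun r => r * (1 - Real.exp (-2 * lam t r))) (Ici 0) := by
  refine monotoneOn_of_deriv_nonneg (convex_Ici 0) (u_cont hsol ht).continuousOn ?_ ?_
  · intro r hr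
    rw [interior_Ici] at hr
    exact (u_deriv hsol ht hr).differentiableAt.differentiableWithinAt
  · intro r hr
    rw [interior_Ici] at hr
    rw [(u_deriv hsol ht hr).deriv]
    have := rm_nonneg hsol ht r
    positivity

lemma lam_nonneg (hsol : IsRegularSolutionEVM q T f lam mu el) {t : ℝ} (ht : t ∈ Ico (0:ℝ) T)
    {r : ℝ} (hr : 0 < r) : 0 ≤ lam t r := by
  have h := u_mono hsol ht (mem_Ici.2 le_rfl) (mem_Ici.2 hr.le) hr.le
  simp only [zero_mul] at h
  have h2 : 0 ≤ 1 - Real.exp (-2 * lam t r) := nonneg_of_mul_nonneg_right h hr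
  have h3 : Real.exp (-2 * lam t r) ≤ 1 := by linarith
  rw [Real.exp_le_one_iff] at h3
  linarith

lemma lam_add_mu_nonpos (hsol : IsRegularSolutionEVM q T f lam mu el) {t : ℝ}
    (ht : t ∈ Ico (0:ℝ) T) {r : ℝ} (hr : 0 < r) : lam t r + mu t r ≤ 0 := by
  have hmono : MonotoneOn (fun r => lam t r + mu t r) (Ioi 0) := by
    refine monotoneOn_of_deriv_nonneg (convex_Ioi 0) ?_ ?_ ?_
    · exact ((lam_contDiff hsol ht).continuous.add (mu_contDiff hsol ht).continuous).continuousOn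
    · exact (((lam_contDiff hsol ht).differentiable one_ne_zero).add
        ((mu_contDiff hsol ht).differentiable one_ne_zero)).differentiableOn
    · intro r hr
      rw [interior_Ioi] at hr
      have hr : 0 < r := hr
      have e := deriv_add ((lam_contDiff hsol ht).differentiable one_ne_zero r)
        ((mu_contDiff hsol ht).differentiable one_ne_zero r)
      have : deriv (fun r => lam t r + mu t r) r = deriv (lam t) r + deriv (mu t) r := e
      rw [this]
      have h1 := lam_eq hsol ht hr
      have h2 := mu_eq hsol ht hr
      have h3 : Real.exp (-2 * lam t r) * (deriv (lam t) r + deriv (mu t) r)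
        = 4 * π * r * (rm f t r + pm f t r) := by
        rw [mul_add, h1, h2]; ring
      have h4 := rm_nonneg hsol ht r
      have h5 := pm_nonneg hsol ht r
      have : 0 ≤ Real.exp (-2 * lam t r) * (deriv (lam t) r + deriv (mu t) r) := by
        rw [h3]; positivity
      exact nonneg_of_mul_nonneg_right this (Real.exp_pos _)
  have hlim : Tendsto (fun r => lam t r + mu t r) atTop (nhds 0) := by
    simpa using (hsol.bc_lam_infty t ht).add (hsol.bc_mu_infty t ht)
  refine ge_of_tendsto hlim ?_
  filter_upwards [eventually_ge_atTop r] with s hs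
  exact hmono hr (lt_of_lt_of_le hr hs) hs

lemma mu_nonpos (hsol : IsRegularSolutionEVM q T f lam mu el) {t : ℝ}
    (ht : t ∈ Ico (0:ℝ) T) {r : ℝ} (hr : 0 < r) : mu t r ≤ 0 := by
  linarith [lam_add_mu_nonpos hsol ht hr, lam_nonneg hsol ht hr]

lemma n_bound (hsol : IsRegularSolutionEVM q T f lam mu el) {t : ℝ} (ht : t ∈ Ico (0:ℝ) T)
    {r : ℝ} (hr : 0 < r) : 0 ≤ (1 - Real.exp (-2 * lam t r)) / (2 * r) ∧
      (1 - Real.exp (-2 * lam t r)) / (2 * r) ≤ 1 / (2 * r) := by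
  have := lam_nonneg hsol ht hr
  have h3 : Real.exp (-2 * lam t r) ≤ 1 := Real.exp_le_one_iff.2 (by linarith)
  have h4 := Real.exp_pos (-2 * lam t r)
  constructor
  · apply div_nonneg <;> linarith
  · gcongr; linarith

lemma lamdot_eq (hsol : IsRegularSolutionEVM q T f lam mu el) {t : ℝ} (ht : t ∈ Ico (0:ℝ) T)
    {r : ℝ} (hr : 0 < r) :
    deriv (fun s => lam s r) t = -(4 * π) * r * Real.exp (lam t r + mu t r) * kEVM f t (e0 r) := by
  have h := hsol.einstein_lamdot t ht (e0 r) (e0_ne hr)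
  rwa [norm_e0 hr] at h

/-- `λ̇ - e^{μ-λ} λ' ≤ 1/(2r)` -/
lemma Dminus (hsol : IsRegularSolutionEVM q T f lam mu el) {t : ℝ} (ht : t ∈ Ico (0:ℝ) T)
    {r : ℝ} (hr : 0 < r) :
    deriv (fun s => lam s r) t - Real.exp (mu t r - lam t r) * deriv (lam t) r ≤ 1 / (2 * r) := by
  have h1 := lamdot_eq hsol ht hr
  have h2 := lam_eq hsol ht hr
  have h3 : Real.exp (mu t r - lam t r) = Real.exp (lam t r + mu t r) * Real.exp (-2 * lam t r) := by
    rw [← Real.exp_add]; ring_nf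
  have h4 := abs_le.1 (abs_k_le hsol ht r)
  obtain ⟨h5, h6⟩ := n_bound hsol ht hr
  have h7 : Real.exp (lam t r + mu t r) ≤ 1 := Real.exp_le_one_iff.2 (lam_add_mu_nonpos hsol ht hr)
  have h8 := Real.exp_pos (lam t r + mu t r)
  rw [h3, mul_assoc, h2, h1]
  set E := Real.exp (lam t r + mu t r)
  set n := (1 - Real.exp (-2 * lam t r)) / (2 * r)
  set k := kEVM f t (e0 r)
  have h9 : 0 ≤ E * (4 * π * r * (rm f t r + k + 1 / 2 * Real.exp (2 * lam t r) * el t r ^ 2)) := by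
    have : 0 ≤ rm f t r + k := by linarith
    positivity
  have : E * n ≤ n := by nlinarith
  nlinarith

/-- `|λ̇| ≤ |λ'| + 1/(2r)` -/
lemma abs_lamdot_le (hsol : IsRegularSolutionEVM q T f lam mu el) {t : ℝ} (ht : t ∈ Ico (0:ℝ) T)
    {r : ℝ} (hr : 0 < r) :
    |deriv (fun s => lam s r) t| ≤ |deriv (lam t) r| + 1 / (2 * r) := by
  have h2 := lam_eq hsol ht hr
  have h4 := abs_k_le hsol ht r
  obtain ⟨h5, h6⟩ := n_bound hsol ht hr
  have h7 : Real.exp (lam t r + mu t r) ≤ 1 := Real.exp_le_one_iff.2 (lam_add_mu_nonpos hsol ht hr)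
  have h8 := Real.exp_pos (lam t r + mu t r)
  rw [lamdot_eq hsol ht hr, abs_mul, abs_mul, abs_mul, abs_neg, abs_of_pos hr, abs_of_pos h8,
    abs_of_pos (by positivity : 0 < 4 * π)]
  have h9 : Real.exp (-2 * lam t r) ≤ 1 := Real.exp_le_one_iff.2 (by
    linarith [lam_nonneg hsol ht hr])
  have h10 : Real.exp (-2 * lam t r) * deriv (lam t) r ≤ |deriv (lam t) r| := by
    calc _ ≤ Real.exp (-2 * lam t r) * |deriv (lam t) r| := by gcongr; exact le_abs_self _
      _ ≤ 1 * |deriv (lam t) r| := by gcongr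
      _ = _ := one_mul _
  have h11 : 0 ≤ 4 * π * r * (1 / 2 * Real.exp (2 * lam t r) * el t r ^ 2) := by positivity
  calc _ ≤ 4 * π * r * 1 * rm f t r := by gcongr
    _ ≤ _ := by nlinarith

end fixedtime

/-! ### The charge estimate -/

section charge

variable {q T : ℝ} {f : ℝ → E3 → E3 → ℝ} {lam mu el : ℝ → ℝ → ℝ}

lemma rm_diff (hsol : IsRegularSolutionEVM q T f lam mu el) {t : ℝ} (ht : t ∈ Ico (0:ℝ) T)
    (r0 : ℝ) : DifferentiableAt ℝ (rm f t) r0 := by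
  have hC1 := f_contDiff hsol ht
  set g : E3 × E3 → ℝ := fun p => f t p.1 p.2 with hg
  have hK := hsol.f_cpt t ht
  set Kv : Set E3 := Prod.snd '' tsupport g with hKv
  have hKvc : IsCompact Kv := hK.isCompact.image continuous_snd
  have he0 : Continuous e0 := by
    have : e0 = fun r => r • e0 1 := funext e0_eq
    rw [this]; fun_prop
  have hcF' : Continuous (fun p : ℝ × E3 =>
      Real.sqrt (1 + ‖p.2‖ ^ 2) * fderiv ℝ g (e0 p.1, p.2) (e0 1, 0)) := by
    have h1 := hC1.continuous_fderiv one_ne_zero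
    have h2 : Continuous (fun p : ℝ × E3 => (e0 p.1, p.2)) := by fun_prop
    have h3 := (h1.comp h2).clm_apply (continuous_const (y := ((e0 1, 0) : E3 × E3)))
    exact (by fun_prop : Continuous fun p : ℝ × E3 => Real.sqrt (1 + ‖p.2‖ ^ 2)).mul h3
  obtain ⟨C, hC⟩ := ((isCompact_Icc (a := r0 - 1) (b := r0 + 1)).prod hKvc).exists_bound_of_continuousOn
    hcF'.continuousOn
  have key := hasDerivAt_integral_of_dominated_loc_of_deriv_le (μ := (volume : Measure E3))
    (F := fun r v => Real.sqrt (1 + ‖v‖ ^ 2) * f t (e0 r) v)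
    (F' := fun r v => Real.sqrt (1 + ‖v‖ ^ 2) * fderiv ℝ g (e0 r, v) (e0 1, 0))
    (bound := Kv.indicator (fun _ => C)) (x₀ := r0)
    (s := Icc (r0 - 1) (r0 + 1)) (Icc_mem_nhds (by linarith) (by linarith))
    (Eventually.of_forall fun r => (fv_int hsol ht (e0 r) cont_sqrt1).aestronglyMeasurable)
    (fv_int hsol ht (e0 r0) cont_sqrt1)
    (hcF'.comp (by fun_prop : Continuous fun v : E3 => (r0, v))).aestronglyMeasurable
    (Eventually.of_forall ?_) ?_ (Eventually.of_forall ?_)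
  · exact key.2.differentiableAt
  · intro v r hr
    by_cases hv : v ∈ Kv
    · rw [indicator_of_mem hv]
      exact hC (r, v) ⟨hr, hv⟩
    · rw [indicator_of_notMem hv]
      have : (e0 r, v) ∉ tsupport g := fun h => hv ⟨_, h, rfl⟩
      rw [fderiv_of_notMem_tsupport ℝ this]
      simp
  · rw [integrable_indicator_iff hKvc.measurableSet]
    exact integrableOn_const hKvc.measure_lt_top.ne
  · intro v r _
    have h1 : HasFDerivAt g (fderiv ℝ g (e0 r, v)) (e0 r, v) :=
      (hC1.differentiable one_ne_zero _).hasFDerivAt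
    have h2 : HasDerivAt (fun r : ℝ => (e0 r, v)) ((e0 1, 0) : E3 × E3) r := by
      have : HasDerivAt e0 (e0 1) r := by
        have : e0 = fun r => r • e0 1 := funext e0_eq
        rw [this]
        simpa [← e0_eq] using (hasDerivAt_id r).smul_const (e0 1)
      exact this.prodMk (hasDerivAt_const r v)
    exact (h1.comp_hasDerivAt r h2).const_mul _

/-- Enclosed charge `Q = r² e^λ e`. -/
def Qf (lam el : ℝ → ℝ → ℝ) (t r : ℝ) : ℝ := r ^ 2 * Real.exp (lam t r) * el t r

lemma Qf_cont (hsol : IsRegularSolutionEVM q T f lam mu el) {t : ℝ} (ht : t ∈ Ico (0:ℝ) T) :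
    Continuous (Qf lam el t) := by
  have := (lam_contDiff hsol ht).continuous
  have := el_continuous hsol ht
  unfold Qf
  fun_prop

lemma Qsq_diff (hsol : IsRegularSolutionEVM q T f lam mu el) {t : ℝ} (ht : t ∈ Ico (0:ℝ) T)
    {r : ℝ} (hr : 0 < r) : DifferentiableAt ℝ (fun r => Qf lam el t r ^ 2) r := by
  have h1 : DifferentiableAt ℝ (lam t) r := (lam_contDiff hsol ht).differentiable one_ne_zero r
  have h2 : DifferentiableAt ℝ (deriv (lam t)) r :=
    (lam'_contDiff hsol ht).differentiable one_ne_zero r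
  have h3 := rm_diff hsol ht r
  have h4 : DifferentiableAt ℝ (fun r => (r ^ 3 * (Real.exp (-2 * lam t r) * deriv (lam t) r
      + (1 - Real.exp (-2 * lam t r)) / (2 * r)) / (2 * π) - 2 * r ^ 4 * rm f t r)) r := by
    have : (2 * r) ≠ 0 := by positivity
    have : (2 * π) ≠ 0 := by positivity
    fun_prop (disch := assumption)
  refine h4.congr_of_eventuallyEq ?_
  filter_upwards [lt_mem_nhds hr] with s hs
  rw [lam_eq hsol ht hs]
  have : Real.exp (2 * lam t s) = Real.exp (lam t s) ^ 2 := by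
    rw [← Real.exp_nat_mul]; norm_num
  rw [Qf, this]
  field_simp
  ring

lemma Qsq_deriv (hsol : IsRegularSolutionEVM q T f lam mu el) {t : ℝ} (ht : t ∈ Ico (0:ℝ) T)
    {r : ℝ} (hr : 0 < r) : HasDerivAt (fun r => Qf lam el t r ^ 2)
      (2 * Qf lam el t r * (q * r ^ 2 * Real.exp (lam t r) * MEVM f t (e0 r))) r := by
  have hd := Qsq_diff hsol ht hr
  by_cases h0 : Qf lam el t r = 0
  · have hmin : IsLocalMin (fun r => Qf lam el t r ^ 2) r := by
      refine Eventually.of_forall fun s => ?_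
      simp only [h0]
      nlinarith [sq_nonneg (Qf lam el t s)]
    have := hd.hasDerivAt
    rw [hmin.deriv_eq_zero] at this
    simpa [h0] using this
  · have hQd : DifferentiableAt ℝ (Qf lam el t) r := by
      have hs : DifferentiableAt ℝ (fun r => Real.sqrt (Qf lam el t r ^ 2)) r :=
        hd.sqrt (by positivity)
      have hc := (Qf_cont hsol ht).continuousAt (x := r)
      rcases lt_or_gt_of_ne h0 with h | h
      · refine hs.neg.congr_of_eventuallyEq ?_
        filter_upwards [hc.eventually (gt_mem_nhds h)] with s hs
        simp [Real.sqrt_sq_eq_abs, abs_of_neg hs]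
      · refine hs.congr_of_eventuallyEq ?_
        filter_upwards [hc.eventually (lt_mem_nhds h)] with s hs
        rw [Real.sqrt_sq_eq_abs, abs_of_pos hs]
    have h1 := hQd.hasDerivAt
    have h2 := hsol.maxwell_r t ht (e0 r) (e0_ne hr)
    rw [norm_e0 hr] at h2
    change deriv (Qf lam el t) r = _ at h2
    rw [h2] at h1
    refine (h1.pow 2).congr_deriv ?_
    norm_num

lemma Q_bound (hsol : IsRegularSolutionEVM q T f lam mu el) {t : ℝ} (ht : t ∈ Ico (0:ℝ) T)
    {ε Lm : ℝ} (hv : ∀ x v : E3, ‖x‖ ≤ ε → f t x v = 0) (hL : ∀ r, 0 < r → ε ≤ r → lam t r ≤ Lm)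
    {r1 : ℝ} (hr1 : 0 < r1) :
    |Qf lam el t r1| ≤ |q| * Real.exp Lm / (8 * π) * (r1 * (1 - Real.exp (-2 * lam t r1))) := by
  set K := |q| * Real.exp Lm / (8 * π) with hKdef
  have hK : 0 ≤ K := by positivity
  set u : ℝ → ℝ := fun r => r * (1 - Real.exp (-2 * lam t r)) with hu
  have hu0 : ∀ r, 0 < r → 0 ≤ u r := by
    intro r hr
    have h := u_mono hsol ht (mem_Ici.2 le_rfl) (mem_Ici.2 hr.le) hr.le
    simpa [hu] using h
  have hMb : ∀ r, 0 < r → |q * r ^ 2 * Real.exp (lam t r) * MEVM f t (e0 r)|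
      ≤ K * (8 * π * r ^ 2 * (rm f t r + 1 / 2 * Real.exp (2 * lam t r) * el t r ^ 2)) := by
    intro r hr
    have hM0 := M_nonneg hsol ht (e0 r)
    have hM1 := M_le_rm hsol ht r
    have hrm := rm_nonneg hsol ht r
    rw [abs_mul, abs_mul, abs_mul, abs_of_nonneg hM0, abs_of_pos (Real.exp_pos _),
      abs_of_pos (by positivity : 0 < r ^ 2)]
    have hKe : K * (8 * π * r ^ 2 * (rm f t r + 1 / 2 * Real.exp (2 * lam t r) * el t r ^ 2))
      = |q| * r ^ 2 * Real.exp Lm * (rm f t r + 1 / 2 * Real.exp (2 * lam t r) * el t r ^ 2) := by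
      rw [hKdef]; field_simp
    rw [hKe]
    have hfld : 0 ≤ 1 / 2 * Real.exp (2 * lam t r) * el t r ^ 2 := by positivity
    by_cases hre : ε ≤ r
    · have := hL r hr hre
      gcongr
      linarith
    · have : MEVM f t (e0 r) = 0 := by
        unfold MEVM
        have : ∀ v, f t (e0 r) v = 0 := fun v => hv _ _ (by rw [norm_e0 hr]; linarith)
        simp [this]
      rw [this, mul_zero]
      positivity
  -- fencing with slack
  have main : ∀ δ, 0 < δ → |Qf lam el t r1| ≤ K * u r1 + δ * (1 + r1) := by
    intro δ hδ
    have hQ0 : Qf lam el t 0 = 0 := by simp [Qf]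
    have hev : ∀ᶠ a in nhdsWithin 0 (Ioi 0), |Qf lam el t a| < δ ∧ a < r1 := by
      have h1 : ∀ᶠ a in nhds (0:ℝ), |Qf lam el t a| < δ := by
        have := (Qf_cont hsol ht).abs.continuousAt (x := (0:ℝ))
        refine this.eventually (gt_mem_nhds ?_)
        simpa [hQ0] using hδ
      exact (h1.and (gt_mem_nhds hr1)).filter_mono nhdsWithin_le_nhds
    obtain ⟨a, ⟨haQ, ha1⟩, ha0⟩ := (hev.and self_mem_nhdsWithin).exists
    have ha0 : 0 < a := ha0
    have hfence := image_le_of_deriv_right_lt_deriv_boundary' (a := a) (b := r1)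
      (f := fun r => Qf lam el t r ^ 2)
      (f' := fun r => 2 * Qf lam el t r * (q * r ^ 2 * Real.exp (lam t r) * MEVM f t (e0 r)))
      (B := fun r => (K * u r + δ * (1 + r)) ^ 2)
      (B' := fun r => 2 * (K * u r + δ * (1 + r)) * (K * (8 * π * r ^ 2 * (rm f t r +
        1 / 2 * Real.exp (2 * lam t r) * el t r ^ 2)) + δ)) ?_ ?_ ?_ ?_ ?_ ?_
      (right_mem_Icc.2 ha1.le)
    · have h1 := hu0 r1 hr1
      exact abs_le_of_sq_le_sq hfence (by positivity)
    · exact ((Qf_cont hsol ht).pow 2).continuousOn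
    · intro r hr
      exact (Qsq_deriv hsol ht (ha0.trans_le hr.1)).hasDerivWithinAt
    · have h1 := hu0 a ha0
      refine sq_le_sq' ?_ ?_ <;> have h2 := abs_lt.1 haQ <;> have h3 : 0 ≤ K * u a := by positivity
      · nlinarith
      · nlinarith
    · have := u_cont hsol ht
      exact Continuous.continuousOn (by fun_prop)
    · intro r hr
      have hr0 : 0 < r := ha0.trans_le hr.1
      have h1 := ((u_deriv hsol ht hr0).const_mul K).add
        (((hasDerivAt_id r).const_add 1).const_mul δ)
      refine ((h1.pow 2).congr_deriv ?_).hasDerivWithinAt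
      simp [hu]
    · intro r hr heq
      have hr0 : 0 < r := ha0.trans_le hr.1
      have h1 := hu0 r hr0
      have hB : 0 < K * u r + δ * (1 + r) := by positivity
      have habs : |Qf lam el t r| = K * u r + δ * (1 + r) := by
        rw [← abs_of_pos hB]; exact (sq_eq_sq_iff_abs_eq_abs _ _).1 heq
      calc 2 * Qf lam el t r * (q * r ^ 2 * Real.exp (lam t r) * MEVM f t (e0 r))
          ≤ |2 * Qf lam el t r * (q * r ^ 2 * Real.exp (lam t r) * MEVM f t (e0 r))| :=
            le_abs_self _
        _ = 2 * (K * u r + δ * (1 + r)) * |q * r ^ 2 * Real.exp (lam t r) * MEVM f t (e0 r)| := by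
            rw [abs_mul, abs_mul, habs, abs_two]
        _ < _ := by
            have := hMb r hr0
            apply mul_lt_mul_of_pos_left _ (by positivity)
            linarith
  by_contra hcon
  push Not at hcon
  set d := |Qf lam el t r1| - K * u r1 with hd
  have hdpos : 0 < d := by rw [hd]; linarith
  have := main (d / (2 * (1 + r1))) (by positivity)
  have h2 : d / (2 * (1 + r1)) * (1 + r1) = d / 2 := by field_simp
  rw [h2] at this
  linarith

/-- Field bound: `e^λ |e| ≤ K / r`. -/
lemma el_bound (hsol : IsRegularSolutionEVM q T f lam mu el) {t : ℝ} (ht : t ∈ Ico (0:ℝ) T)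
    {ε Lm : ℝ} (hv : ∀ x v : E3, ‖x‖ ≤ ε → f t x v = 0) (hL : ∀ r, 0 < r → ε ≤ r → lam t r ≤ Lm)
    {r : ℝ} (hr : 0 < r) :
    Real.exp (lam t r) * |el t r| ≤ |q| * Real.exp Lm / (8 * π) / r := by
  have h := Q_bound hsol ht hv hL hr
  have hE := Real.exp_pos (-2 * lam t r)
  have hK : 0 ≤ |q| * Real.exp Lm / (8 * π) := by positivity
  set K := |q| * Real.exp Lm / (8 * π)
  have h2 : K * (r * (1 - Real.exp (-2 * lam t r))) ≤ K * r := by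
    gcongr
    nlinarith
  rw [Qf, abs_mul, abs_mul, abs_of_pos (Real.exp_pos _), abs_of_pos (by positivity : 0 < r ^ 2)] at h
  rw [le_div_iff₀ hr]
  have h3 : r * (Real.exp (lam t r) * |el t r| * r) ≤ r * K := by nlinarith
  exact le_of_mul_le_mul_left h3 hr

end charge

/-! ### A maximum principle, the bound on `λ`, and transport barriers -/

lemma le_of_improvable {F : Type*} [TopologicalSpace F] {K : Set F} (hK : IsCompact K) {g : F → ℝ}
    (hg : ContinuousOn g K) {c : ℝ} (h : ∀ p ∈ K, c < g p → ∃ p' ∈ K, g p < g p') :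
    ∀ p ∈ K, g p ≤ c := by
  intro p hp
  by_contra hcon
  push Not at hcon
  obtain ⟨m, hm, hmax⟩ := hK.exists_isMaxOn ⟨p, hp⟩ hg
  obtain ⟨p', hp', hlt⟩ := h m hm (hcon.trans_le (hmax hp))
  exact absurd (hmax hp') (not_le.2 hlt)

lemma eventually_gt_of_deriv_neg {φ : ℝ → ℝ} {D : ℝ} (h : HasDerivAt φ D 0) (hD : D < 0) :
    ∀ᶠ s in nhdsWithin 0 (Iio 0), φ 0 < φ s := by
  have h1 := hasDerivAt_iff_tendsto_slope_left_right.1 h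
  filter_upwards [h1.1.eventually (gt_mem_nhds hD), self_mem_nhdsWithin] with s hs hs0
  have hs0 : s < 0 := hs0
  rw [slope_def_field, sub_zero] at hs
  by_contra hcon
  push Not at hcon
  have : 0 ≤ (φ s - φ 0) / s := div_nonneg_of_nonpos (by linarith) hs0.le
  linarith

section barrier

variable {q T : ℝ} {f : ℝ → E3 → E3 → ℝ} {lam mu el : ℝ → ℝ → ℝ}

lemma lam_chain (hsol : IsRegularSolutionEVM q T f lam mu el) {t : ℝ} (ht : t ∈ Ioo (0:ℝ) T)
    {a b : ℝ → ℝ} {a' b' r : ℝ} (ha0 : a 0 = t) (hb0 : b 0 = r)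
    (ha : HasDerivAt a a' 0) (hb : HasDerivAt b b' 0) :
    HasDerivAt (fun h => lam (a h) (b h))
      (deriv (fun s => lam s r) t * a' + deriv (lam t) r * b') 0 := by
  have hnhds : (Ico (0:ℝ) T) ×ˢ (univ : Set ℝ) ∈ nhds (t, r) :=
    prod_mem_nhds (Ico_mem_nhds ht.1 ht.2) univ_mem
  have hF : DifferentiableAt ℝ (fun p : ℝ × ℝ => lam p.1 p.2) (t, r) :=
    (hsol.lam_c1.contDiffAt hnhds).differentiableAt one_ne_zero
  set L := fderiv ℝ (fun p : ℝ × ℝ => lam p.1 p.2) (t, r) with hL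
  have hF := hF.hasFDerivAt
  rw [← hL] at hF
  have h1 : HasDerivAt (fun s => lam s r) (L (1, 0)) t := by
    have hc : HasDerivAt (fun s : ℝ => (s, r)) ((1, 0) : ℝ × ℝ) t :=
      (hasDerivAt_id t).prodMk (hasDerivAt_const t r)
    exact hF.comp_hasDerivAt t hc
  have h2 : HasDerivAt (lam t) (L (0, 1)) r := by
    have hc : HasDerivAt (fun s : ℝ => (t, s)) ((0, 1) : ℝ × ℝ) r :=
      (hasDerivAt_const r t).prodMk (hasDerivAt_id r)
    exact hF.comp_hasDerivAt r hc
  rw [h1.deriv, h2.deriv]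
  have hab : HasDerivAt (fun h => (a h, b h)) (a', b') 0 := ha.prodMk hb
  have hF' : HasFDerivAt (fun p : ℝ × ℝ => lam p.1 p.2) L ((fun h => (a h, b h)) 0) := by
    simpa [ha0, hb0] using hF
  refine (hF'.comp_hasDerivAt 0 hab).congr_deriv ?_
  have : ((a', b') : ℝ × ℝ) = a' • ((1, 0) : ℝ × ℝ) + b' • ((0, 1) : ℝ × ℝ) := by ext <;> simp
  rw [this, map_add, map_smul, map_smul]
  simp only [smul_eq_mul]
  ring

lemma exp_mu_lam_le_one (hsol : IsRegularSolutionEVM q T f lam mu el) {t : ℝ}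
    (ht : t ∈ Ico (0:ℝ) T) {r : ℝ} (hr : 0 < r) : Real.exp (mu t r - lam t r) ≤ 1 :=
  Real.exp_le_one_iff.2 (by linarith [mu_nonpos hsol ht hr, lam_nonneg hsol ht hr])

lemma lam0_bdd (hsol : IsRegularSolutionEVM q T f lam mu el) (hT : 0 < T) :
    ∃ c, ∀ r, 0 < r → lam 0 r ≤ c := by
  have h0 : (0:ℝ) ∈ Ico (0:ℝ) T := ⟨le_rfl, hT⟩
  have h1 := (hsol.bc_lam_infty 0 h0).eventually (gt_mem_nhds (zero_lt_one (α := ℝ)))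
  obtain ⟨R, hR⟩ := eventually_atTop.1 h1
  obtain ⟨C, hC⟩ := (isCompact_Icc (a := (0:ℝ)) (b := R)).exists_bound_of_continuousOn
    (lam_contDiff hsol h0).continuous.continuousOn
  refine ⟨max C 1, fun r hr => ?_⟩
  rcases le_total r R with h | h
  · exact ((le_abs_self _).trans (hC r ⟨hr.le, h⟩)).trans (le_max_left _ _)
  · exact (hR r h).le.trans (le_max_right _ _)

lemma lam_bdd (hsol : IsRegularSolutionEVM q T f lam mu el) (hT : 0 < T) {ε : ℝ} (hε : 0 < ε) :
    ∃ Lm, ∀ t ∈ Ico (0:ℝ) T, ∀ r, ε ≤ r → lam t r ≤ Lm := by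
  obtain ⟨c, hc⟩ := lam0_bdd hsol hT
  set C := 1 / (2 * ε) + 1 with hC
  have hCpos : 0 < C := by positivity
  refine ⟨c + C * T, fun t1 ht1 r1 hr1 => ?_⟩
  set R := r1 + 2 * t1 with hR
  set K : Set (ℝ × ℝ) := (Icc 0 t1 ×ˢ Icc ε R) ∩ {p | p.2 + 2 * p.1 ≤ R} with hKd
  have hK : IsCompact K := (isCompact_Icc.prod isCompact_Icc).inter_right
    (isClosed_le (by fun_prop) (by fun_prop))
  have hsub : K ⊆ (Ico (0:ℝ) T) ×ˢ (univ : Set ℝ) := fun p hp =>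
    ⟨⟨hp.1.1.1, hp.1.1.2.trans_lt ht1.2⟩, mem_univ _⟩
  have hcont : ContinuousOn (fun p : ℝ × ℝ => lam p.1 p.2 - C * p.1) K :=
    (hsol.lam_c1.continuousOn.mono hsub).sub (by fun_prop)
  have := le_of_improvable hK hcont (c := c) ?_ (t1, r1) ⟨⟨⟨ht1.1, le_rfl⟩, ⟨hr1, by
    rw [hR]; linarith [ht1.1]⟩⟩, le_of_eq hR.symm⟩
  · simp only at this
    nlinarith [ht1.1, ht1.2]
  · rintro ⟨s, r⟩ ⟨⟨⟨hs0, hs1⟩, ⟨hr0, hrR⟩⟩, hRR⟩ hgt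
    simp only [mem_setOf_eq] at hs0 hs1 hr0 hrR hRR hgt
    have hrpos : 0 < r := hε.trans_le hr0
    rcases hs0.eq_or_lt with rfl | hspos
    · have := hc r hrpos
      linarith
    have hsI : s ∈ Ioo (0:ℝ) T := ⟨hspos, hs1.trans_lt ht1.2⟩
    set cc := Real.exp (mu s r - lam s r) with hcc
    have hcc1 : cc ≤ 1 := exp_mu_lam_le_one hsol ⟨hs0, hsI.2⟩ hrpos
    have hcc0 : 0 < cc := Real.exp_pos _
    have hd : HasDerivAt (fun h : ℝ => lam (s + h) (r - cc * h) - C * (s + h))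
        (deriv (fun s => lam s r) s * 1 + deriv (lam s) r * (-cc) - C * 1) 0 := by
      have h1 : HasDerivAt (fun h : ℝ => s + h) 1 0 := (hasDerivAt_id 0).const_add s
      have h2 : HasDerivAt (fun h : ℝ => r - cc * h) (-cc) 0 := by
        simpa using ((hasDerivAt_id (0:ℝ)).const_mul cc).const_sub r
      exact (lam_chain hsol hsI (by simp) (by simp) h1 h2).sub (h1.const_mul C)
    have hneg : deriv (fun s => lam s r) s * 1 + deriv (lam s) r * (-cc) - C * 1 < 0 := by
      have h1 := Dminus hsol ⟨hs0, hsI.2⟩ hrpos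
      rw [← hcc] at h1
      have h2 : 1 / (2 * r) ≤ 1 / (2 * ε) := by gcongr
      rw [hC]
      linarith
    have hev := eventually_gt_of_deriv_neg hd hneg
    have hev2 : ∀ᶠ h in nhdsWithin (0:ℝ) (Iio 0), -s < h :=
      (lt_mem_nhds (by linarith : -s < 0)).filter_mono nhdsWithin_le_nhds
    obtain ⟨h, ⟨h1, h2⟩, h3⟩ := ((hev.and hev2).and self_mem_nhdsWithin).exists
    have h3 : h < 0 := h3
    have h4 : -h * cc ≤ -h := by nlinarith
    have h5 : 0 ≤ -h * cc := by nlinarith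
    refine ⟨(s + h, r - cc * h), ⟨⟨⟨?_, ?_⟩, ⟨?_, ?_⟩⟩, ?_⟩, ?_⟩ <;>
      simp only [mem_setOf_eq] <;> try nlinarith
    simpa using h1

/-- spatial component of the characteristic field -/
def bx (lam mu : ℝ → ℝ → ℝ) (t : ℝ) (x v : E3) : E3 :=
  (Real.exp (mu t ‖x‖ - lam t ‖x‖) / Real.sqrt (1 + ‖v‖ ^ 2)) • v

/-- strength of the radial force -/
def Ac (q : ℝ) (lam mu el : ℝ → ℝ → ℝ) (t : ℝ) (x v : E3) : ℝ :=
  Real.exp (mu t ‖x‖ - lam t ‖x‖) * deriv (mu t) ‖x‖ * Real.sqrt (1 + ‖v‖ ^ 2)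
            + deriv (fun s => lam s ‖x‖) t * (⟪x, v⟫ / ‖x‖)
            - q * Real.exp (lam t ‖x‖ + mu t ‖x‖) * el t ‖x‖

/-- velocity component of the characteristic field -/
def bv (q : ℝ) (lam mu el : ℝ → ℝ → ℝ) (t : ℝ) (x v : E3) : E3 :=
  -(Ac q lam mu el t x v / ‖x‖) • x

lemma f_transport (hsol : IsRegularSolutionEVM q T f lam mu el) {t : ℝ} (ht : t ∈ Ioo (0:ℝ) T)
    {x : E3} (hx : x ≠ 0) (v : E3) :
    HasDerivAt (fun h : ℝ => f (t + h) (x + h • bx lam mu t x v) (v + h • bv q lam mu el t x v))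
      0 0 := by
  have hnhds : (Ico (0:ℝ) T) ×ˢ (univ : Set (E3 × E3)) ∈ nhds (t, x, v) :=
    prod_mem_nhds (Ico_mem_nhds ht.1 ht.2) univ_mem
  have hF := ((hsol.f_c1.contDiffAt hnhds).differentiableAt one_ne_zero).hasFDerivAt
  have hV := hsol.vlasov t ⟨ht.1.le, ht.2⟩ x hx v
  have hc : HasDerivAt (fun h : ℝ => (t + h, x + h • bx lam mu t x v, v + h • bv q lam mu el t x v))
      (1, bx lam mu t x v, bv q lam mu el t x v) 0 := by
    refine HasDerivAt.prodMk ((hasDerivAt_id 0).const_add t) (HasDerivAt.prodMk ?_ ?_)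
    · simpa using ((hasDerivAt_id (0:ℝ)).smul_const (bx lam mu t x v)).const_add x
    · simpa using ((hasDerivAt_id (0:ℝ)).smul_const (bv q lam mu el t x v)).const_add v
  have hF' : HasFDerivAt (fun p : ℝ × E3 × E3 => f p.1 p.2.1 p.2.2)
      (fderiv ℝ (fun p : ℝ × E3 × E3 => f p.1 p.2.1 p.2.2) (t, x, v))
      ((fun h : ℝ => (t + h, x + h • bx lam mu t x v, v + h • bv q lam mu el t x v)) 0) := by
    simpa using hF
  exact (hF'.comp_hasDerivAt 0 hc).congr_deriv hV

lemma norm_bx_le (hsol : IsRegularSolutionEVM q T f lam mu el) {t : ℝ} (ht : t ∈ Ico (0:ℝ) T)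
    {x : E3} (hx : x ≠ 0) (v : E3) : ‖bx lam mu t x v‖ ≤ 1 := by
  have h1 := exp_mu_lam_le_one hsol ht (norm_pos_iff.2 hx)
  have h2 := norm_le_sqrt1 v
  have h3 := sqrt1_pos v
  rw [bx, norm_smul, Real.norm_eq_abs, abs_of_pos (by positivity), div_mul_eq_mul_div,
    div_le_one h3]
  calc _ ≤ 1 * ‖v‖ := by gcongr
    _ ≤ _ := by rw [one_mul]; exact h2

lemma bv_bound (hsol : IsRegularSolutionEVM q T f lam mu el) {ε : ℝ} (hε : 0 < ε) {t1 : ℝ}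
    (ht1 : t1 < T) (R : ℝ) :
    ∃ C, 0 ≤ C ∧ ∀ t ∈ Icc (0:ℝ) t1, ∀ x v : E3, ε ≤ ‖x‖ → ‖x‖ ≤ R →
      |⟪v, bv q lam mu el t x v⟫| ≤ C * (1 + ‖v‖ ^ 2) := by
  have hsub : Icc 0 t1 ×ˢ Icc ε R ⊆ (Ico (0:ℝ) T) ×ˢ (univ : Set ℝ) := fun p hp =>
    ⟨⟨hp.1.1, hp.1.2.trans_lt ht1⟩, mem_univ _⟩
  have hK : IsCompact (Icc 0 t1 ×ˢ Icc ε R) := isCompact_Icc.prod isCompact_Icc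
  obtain ⟨a1, h1⟩ := hK.exists_bound_of_continuousOn (hsol.mu'_c1.continuousOn.mono hsub)
  obtain ⟨a2, h2⟩ := hK.exists_bound_of_continuousOn (hsol.lam'_c1.continuousOn.mono hsub)
  obtain ⟨a3, h3⟩ := hK.exists_bound_of_continuousOn (hsol.el_cont.mono hsub)
  refine ⟨|a1| + (|a2| + 1 / (2 * ε)) + |q| * |a3|, by positivity, ?_⟩
  intro t ht x v hx hxR
  have htT : t ∈ Ico (0:ℝ) T := ⟨ht.1, ht.2.trans_lt ht1⟩
  have hr : 0 < ‖x‖ := hε.trans_le hx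
  have hmem : (t, ‖x‖) ∈ Icc 0 t1 ×ˢ Icc ε R := ⟨ht, hx, hxR⟩
  have b1 : |deriv (mu t) ‖x‖| ≤ |a1| := (h1 _ hmem).trans (le_abs_self _)
  have b2 : |deriv (lam t) ‖x‖| ≤ |a2| := (h2 _ hmem).trans (le_abs_self _)
  have b3 : |el t ‖x‖| ≤ |a3| := (h3 _ hmem).trans (le_abs_self _)
  have b4 : |deriv (fun s => lam s ‖x‖) t| ≤ |a2| + 1 / (2 * ε) := by
    refine (abs_lamdot_le hsol htT hr).trans ?_
    gcongr
  have e1 := exp_mu_lam_le_one hsol htT hr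
  have e2 : Real.exp (lam t ‖x‖ + mu t ‖x‖) ≤ 1 :=
    Real.exp_le_one_iff.2 (lam_add_mu_nonpos hsol htT hr)
  have hw := abs_w_le x v
  have hE := norm_le_sqrt1 v
  have hE1 := one_le_sqrt1 v
  have hE2 := sq_sqrt1 v
  set E := Real.sqrt (1 + ‖v‖ ^ 2) with hEdef
  have hA : |Ac q lam mu el t x v| ≤ (|a1| + (|a2| + 1 / (2 * ε)) + |q| * |a3|) * E := by
    unfold Ac
    refine (abs_sub _ _).trans ?_
    refine (add_le_add_left (abs_add_le _ _) _).trans ?_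
    simp only [abs_mul, Real.abs_exp, ← hEdef]
    rw [abs_of_pos (by linarith : 0 < E)]
    have c1 : Real.exp (mu t ‖x‖ - lam t ‖x‖) * |deriv (mu t) ‖x‖| * E ≤ 1 * |a1| * E := by
      gcongr
    have c2 : |deriv (fun s => lam s ‖x‖) t| * |⟪x, v⟫ / ‖x‖| ≤ (|a2| + 1 / (2 * ε)) * E := by
      gcongr
      exact hw.trans hE
    have c3 : |q| * Real.exp (lam t ‖x‖ + mu t ‖x‖) * |el t ‖x‖| ≤ |q| * 1 * |a3| := by
      gcongr
    have c4 : |q| * |a3| ≤ |q| * |a3| * E := le_mul_of_one_le_right (by positivity) hE1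
    linarith
  have hin : ⟪v, bv q lam mu el t x v⟫ = -(Ac q lam mu el t x v * (⟪x, v⟫ / ‖x‖)) := by
    rw [bv, real_inner_smul_right, real_inner_comm]
    ring
  rw [hin, abs_neg, abs_mul, ← hE2]
  calc _ ≤ ((|a1| + (|a2| + 1 / (2 * ε)) + |q| * |a3|) * E) * E := by
        gcongr
        exact hw.trans hE
    _ = _ := by ring

/-- Transport barrier: a quantity that does not increase along characteristics on the support. -/
lemma transport_barrier (hsol : IsRegularSolutionEVM q T f lam mu el) {ε : ℝ} (hε : 0 < ε)
    (hvanish : ∀ t, 0 ≤ t → t < T → ∀ x v : E3, ‖x‖ ≤ ε → f t x v = 0)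
    (Ψ : ℝ → E3 → E3 → ℝ) (c : ℝ) {t1 : ℝ} (ht1 : t1 ∈ Ico (0:ℝ) T)
    (hcont : ContinuousOn (fun p : ℝ × E3 × E3 => Ψ p.1 p.2.1 p.2.2)
      (Icc 0 t1 ×ˢ ({x | ε ≤ ‖x‖} ×ˢ univ)))
    (hD : ∀ t, 0 < t → t ≤ t1 → ∀ x v : E3, ε < ‖x‖ → f t x v ≠ 0 → c < Ψ t x v → ∃ D ≤ 0,
      HasDerivAt (fun h : ℝ => Ψ (t + h) (x + h • bx lam mu t x v) (v + h • bv q lam mu el t x v)) D 0)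
    (hinit : ∀ x v : E3, f 0 x v ≠ 0 → Ψ 0 x v ≤ c) :
    ∀ t ∈ Icc 0 t1, ∀ x v : E3, f t x v ≠ 0 → Ψ t x v ≤ c := by
  intro t2 ht2 x2 v2 hf2
  by_contra hcon
  push Not at hcon
  have ht2T : t2 ∈ Ico (0:ℝ) T := ⟨ht2.1, ht2.2.trans_lt ht1.2⟩
  have hf2pos : 0 < f t2 x2 v2 := lt_of_le_of_ne (hsol.f_nonneg t2 ht2T x2 v2) hf2.symm
  have hx2 : ε < ‖x2‖ := by
    by_contra h
    exact hf2 (hvanish t2 ht2T.1 ht2T.2 x2 v2 (not_lt.1 h))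
  set R := ‖x2‖ + 2 * t2 with hR
  obtain ⟨C0, hC0, hbv⟩ := bv_bound hsol hε ht1.2 R
  set C := 2 * C0 + 1 with hC
  set V := (1 + ‖v2‖ ^ 2) * Real.exp (C * t2) with hV
  set d0 := f t2 x2 v2 * (Ψ t2 x2 v2 - c) with hd0
  have hd0pos : 0 < d0 := mul_pos hf2pos (by linarith)
  set δ := d0 / (2 * (t2 + 1)) with hδ
  have ht20 := ht2.1
  have hδpos : 0 < δ := by positivity
  set K : Set (ℝ × E3 × E3) := (Icc 0 t2 ×ˢ (Metric.closedBall 0 R ×ˢ Metric.closedBall 0 V)) ∩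
    {p | ε ≤ ‖p.2.1‖ ∧ ‖p.2.1‖ + 2 * p.1 ≤ R ∧ (1 + ‖p.2.2‖ ^ 2) * Real.exp (C * p.1) ≤ V} with hKd
  have hK : IsCompact K := by
    refine (isCompact_Icc.prod ((isCompact_closedBall _ _).prod
      (isCompact_closedBall _ _))).inter_right ?_
    have k1 : IsClosed {p : ℝ × E3 × E3 | ε ≤ ‖p.2.1‖} := isClosed_le (by fun_prop) (by fun_prop)
    have k2 : IsClosed {p : ℝ × E3 × E3 | ‖p.2.1‖ + 2 * p.1 ≤ R} :=
      isClosed_le (by fun_prop) (by fun_prop)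
    have k3 : IsClosed {p : ℝ × E3 × E3 | (1 + ‖p.2.2‖ ^ 2) * Real.exp (C * p.1) ≤ V} :=
      isClosed_le (by fun_prop) (by fun_prop)
    exact k1.inter (k2.inter k3)
  have hmemK : ∀ (t : ℝ) (x v : E3), 0 ≤ t → t ≤ t2 → ε ≤ ‖x‖ → ‖x‖ + 2 * t ≤ R →
      (1 + ‖v‖ ^ 2) * Real.exp (C * t) ≤ V → (t, x, v) ∈ K := by
    intro t x v h0 h1 h2 h3 h4
    refine ⟨⟨⟨h0, h1⟩, ?_, ?_⟩, h2, h3, h4⟩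
    · rw [mem_closedBall_zero_iff]; simp only; linarith
    · rw [mem_closedBall_zero_iff]
      simp only
      have : 1 ≤ Real.exp (C * t) := Real.one_le_exp (by positivity)
      have h5 : (1 + ‖v‖ ^ 2) * 1 ≤ (1 + ‖v‖ ^ 2) * Real.exp (C * t) := by gcongr
      nlinarith [sq_nonneg (‖v‖ - 1), norm_nonneg v]
  have hcontg : ContinuousOn (fun p : ℝ × E3 × E3 =>
      f p.1 p.2.1 p.2.2 * (Ψ p.1 p.2.1 p.2.2 - c) - δ * p.1) K := by
    refine ContinuousOn.sub (ContinuousOn.mul (hsol.f_c1.continuousOn.mono ?_)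
      ((hcont.mono ?_).sub continuousOn_const)) (by fun_prop)
    · exact fun p hp => ⟨⟨hp.1.1.1, hp.1.1.2.trans_lt ht2T.2⟩, mem_univ _⟩
    · exact fun p hp => ⟨⟨hp.1.1.1, hp.1.1.2.trans ht2.2⟩, hp.2.1, mem_univ _⟩
  have hfin := le_of_improvable hK hcontg (c := 0) ?_ (t2, x2, v2)
    (hmemK t2 x2 v2 ht20 le_rfl hx2.le le_rfl le_rfl)
  · simp only at hfin
    rw [← hd0] at hfin
    have h2 : δ * t2 ≤ d0 / 2 := by
      rw [hδ, div_mul_eq_mul_div, div_le_div_iff₀ (by positivity) (by norm_num)]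
      nlinarith
    linarith
  · rintro ⟨t, x, v⟩ ⟨⟨⟨h0, h1⟩, -⟩, h2, h3, h4⟩ hgt
    simp only at h0 h1 h2 h3 h4 hgt
    have htT : t ∈ Ico (0:ℝ) T := ⟨h0, h1.trans_lt ht2T.2⟩
    have hfn := hsol.f_nonneg t htT x v
    have hpos : 0 < f t x v * (Ψ t x v - c) := by nlinarith
    have hfpos : 0 < f t x v := by
      rcases hfn.eq_or_lt with h | h
      · rw [← h, zero_mul] at hpos; exact absurd hpos (lt_irrefl _)
      · exact h
    have hΨ : c < Ψ t x v := by
      have := (mul_pos_iff_of_pos_left hfpos).1 hpos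
      linarith
    rcases h0.eq_or_lt with rfl | htpos
    · exact absurd (hinit x v hfpos.ne') (not_le.2 hΨ)
    have hxε : ε < ‖x‖ := by
      by_contra h
      exact hfpos.ne' (hvanish t htT.1 htT.2 x v (not_lt.1 h))
    have hx0 : x ≠ 0 := norm_pos_iff.1 (hε.trans hxε)
    have htI : t ∈ Ioo (0:ℝ) T := ⟨htpos, htT.2⟩
    obtain ⟨D, hD0, hDd⟩ := hD t htpos (h1.trans ht2.2) x v hxε hfpos.ne' hΨ
    have hft := f_transport hsol htI hx0 v
    set X := bx lam mu t x v with hX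
    set W := bv q lam mu el t x v with hW
    have h_t : HasDerivAt (fun h : ℝ => t + h) 1 0 := (hasDerivAt_id 0).const_add t
    have hg : HasDerivAt (fun h : ℝ => f (t + h) (x + h • X) (v + h • W) *
        (Ψ (t + h) (x + h • X) (v + h • W) - c) - δ * (t + h)) (f t x v * D - δ) 0 := by
      refine ((hft.mul (hDd.sub_const c)).sub (h_t.const_mul δ)).congr_deriv ?_
      simp
    have hev := eventually_gt_of_deriv_neg hg (by nlinarith)
    have hN : HasDerivAt (fun h : ℝ => -((1 + ‖v + h • W‖ ^ 2) * Real.exp (C * (t + h))))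
        (-((2 * ⟪v, W⟫) * Real.exp (C * t) + (1 + ‖v‖ ^ 2) * (Real.exp (C * t) * C))) 0 := by
      have hv : HasDerivAt (fun h : ℝ => v + h • W) W 0 := by
        simpa using ((hasDerivAt_id (0:ℝ)).smul_const W).const_add v
      have := ((hv.norm_sq.const_add 1).mul ((h_t.const_mul C).exp)).neg
      refine this.congr_deriv ?_
      simp
    have hNneg : -((2 * ⟪v, W⟫) * Real.exp (C * t) + (1 + ‖v‖ ^ 2) * (Real.exp (C * t) * C)) < 0 := by
      have hb := (abs_le.1 (hbv t ⟨h0, h1.trans ht2.2⟩ x v h2 (by linarith))).1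
      have he := Real.exp_pos (C * t)
      have : 0 < 2 * ⟪v, W⟫ + (1 + ‖v‖ ^ 2) * C := by
        rw [hC]
        nlinarith [sq_nonneg ‖v‖]
      nlinarith
    have hev2 := eventually_gt_of_deriv_neg hN hNneg
    have hev3 : ∀ᶠ h in nhdsWithin (0:ℝ) (Iio 0), -t < h :=
      (lt_mem_nhds (by linarith : -t < 0)).filter_mono nhdsWithin_le_nhds
    have hev4 : ∀ᶠ h in nhdsWithin (0:ℝ) (Iio 0), ε < ‖x + h • X‖ := by
      have hc : ContinuousAt (fun h : ℝ => ‖x + h • X‖) 0 := by fun_prop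
      exact (hc.eventually (lt_mem_nhds (by simpa using hxε))).filter_mono nhdsWithin_le_nhds
    obtain ⟨h, ⟨⟨⟨g1, g2⟩, g3⟩, g4⟩, g5⟩ :=
      ((((hev.and hev2).and hev3).and hev4).and self_mem_nhdsWithin).exists
    have g5 : h < 0 := g5
    refine ⟨(t + h, x + h • X, v + h • W), hmemK _ _ _ (by linarith) (by linarith) g4.le ?_ ?_, ?_⟩
    · have k1 : ‖x + h • X‖ ≤ ‖x‖ + ‖h • X‖ := norm_add_le _ _
      have k2 : ‖h • X‖ ≤ -h := by
        rw [norm_smul, Real.norm_eq_abs, abs_of_neg g5]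
        have := norm_bx_le hsol htT hx0 v
        nlinarith
      linarith
    · simp at g2
      linarith
    · simpa using g1

end barrier

/-! ### A priori bounds on the support of `f` -/

lemma line_deriv (x X : E3) : HasDerivAt (fun h : ℝ => x + h • X) X 0 := by
  simpa using ((hasDerivAt_id (0:ℝ)).smul_const X).const_add x

lemma time_deriv (t : ℝ) : HasDerivAt (fun h : ℝ => t + h) 1 0 := (hasDerivAt_id 0).const_add t

lemma norm_line_deriv {x : E3} (hx : x ≠ 0) (X : E3) :
    HasDerivAt (fun h : ℝ => ‖x + h • X‖) (⟪x, X⟫ / ‖x‖) 0 := by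
  have h1 := (line_deriv x X).norm_sq
  have hx' : 0 < ‖x‖ := norm_pos_iff.2 hx
  have h2 := h1.sqrt (by simp [hx])
  simp only [zero_smul, add_zero, Real.sqrt_sq (norm_nonneg _)] at h2
  refine h2.congr_deriv ?_
  field_simp

lemma inner_line_deriv (x X v W : E3) :
    HasDerivAt (fun h : ℝ => ⟪x + h • X, v + h • W⟫) (⟪x, W⟫ + ⟪X, v⟫) 0 := by
  simpa using (line_deriv x X).inner ℝ (line_deriv v W)

section apriori

variable {q T : ℝ} {f : ℝ → E3 → E3 → ℝ} {lam mu el : ℝ → ℝ → ℝ}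

lemma init_bdd (hsol : IsRegularSolutionEVM q T f lam mu el) (hT : 0 < T) :
    ∃ B, 0 ≤ B ∧ ∀ x v : E3, f 0 x v ≠ 0 → ‖x‖ ≤ B ∧ ‖v‖ ≤ B := by
  obtain ⟨B, hB⟩ := (hsol.f_cpt 0 ⟨le_rfl, hT⟩).isCompact.isBounded.exists_norm_le
  refine ⟨|B|, abs_nonneg _, fun x v h => ?_⟩
  have h1 := (hB (x, v) (subset_tsupport _ h)).trans (le_abs_self B)
  exact ⟨(norm_fst_le (x, v)).trans h1, (norm_snd_le (x, v)).trans h1⟩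

lemma f_bdd (hsol : IsRegularSolutionEVM q T f lam mu el) (hT : 0 < T) {ε : ℝ} (hε : 0 < ε)
    (hvanish : ∀ t, 0 ≤ t → t < T → ∀ x v : E3, ‖x‖ ≤ ε → f t x v = 0) :
    ∃ F, 0 ≤ F ∧ ∀ t ∈ Ico 0 T, ∀ x v : E3, f t x v ≤ F := by
  have h0 : (0:ℝ) ∈ Ico (0:ℝ) T := ⟨le_rfl, hT⟩
  obtain ⟨F, hF⟩ := (f_contDiff hsol h0).continuous.bounded_above_of_compact_support
    (hsol.f_cpt 0 h0)
  refine ⟨|F|, abs_nonneg _, fun t ht x v => ?_⟩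
  by_cases hf : f t x v = 0
  · rw [hf]; exact abs_nonneg _
  refine transport_barrier hsol hε hvanish f |F| ht ?_ ?_ ?_ t ⟨ht.1, le_rfl⟩ x v hf
  · exact hsol.f_c1.continuousOn.mono fun p hp => ⟨⟨hp.1.1, hp.1.2.trans_lt ht.2⟩, mem_univ _⟩
  · intro s hs hst y w hy _ _
    exact ⟨0, le_rfl, f_transport hsol ⟨hs, hst.trans_lt ht.2⟩ (norm_pos_iff.1 (hε.trans hy)) w⟩
  · intro y w _
    exact (le_abs_self _).trans ((hF (y, w)).trans (le_abs_self _))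

lemma x_bdd (hsol : IsRegularSolutionEVM q T f lam mu el) (hT : 0 < T) {ε : ℝ} (hε : 0 < ε)
    (hvanish : ∀ t, 0 ≤ t → t < T → ∀ x v : E3, ‖x‖ ≤ ε → f t x v = 0) :
    ∃ R, 0 ≤ R ∧ ∀ t ∈ Ico 0 T, ∀ x v : E3, f t x v ≠ 0 → ‖x‖ ≤ R := by
  obtain ⟨B, hB0, hB⟩ := init_bdd hsol hT
  refine ⟨B + T, by positivity, fun t ht x v hf => ?_⟩
  have := transport_barrier hsol hε hvanish (fun t x _ => ‖x‖ - t) B ht ?_ ?_ ?_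
    t ⟨ht.1, le_rfl⟩ x v hf
  · linarith [ht.2]
  · fun_prop
  · intro s hs hst y w hy _ _
    have hy0 : y ≠ 0 := norm_pos_iff.1 (hε.trans hy)
    refine ⟨_, ?_, (norm_line_deriv hy0 _).sub (time_deriv s)⟩
    have h1 := (le_abs_self _).trans (abs_w_le y (bx lam mu s y w))
    have h2 := norm_bx_le hsol ⟨hs.le, hst.trans_lt ht.2⟩ hy0 w
    linarith
  · intro y w h
    simpa using (hB y w h).1

/-- squared angular momentum -/
def Lg (x v : E3) : ℝ := ‖x‖ ^ 2 * ‖v‖ ^ 2 - ⟪x, v⟫ ^ 2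

lemma Lg_nonneg (x v : E3) : 0 ≤ Lg x v := by
  have := abs_real_inner_le_norm x v
  unfold Lg
  rw [← sq_abs ⟪x, v⟫, ← mul_pow]
  have h2 : |⟪x, v⟫| ^ 2 ≤ (‖x‖ * ‖v‖) ^ 2 := by gcongr
  linarith

lemma Lg_bdd (hsol : IsRegularSolutionEVM q T f lam mu el) (hT : 0 < T) {ε : ℝ} (hε : 0 < ε)
    (hvanish : ∀ t, 0 ≤ t → t < T → ∀ x v : E3, ‖x‖ ≤ ε → f t x v = 0) :
    ∃ L0, 0 ≤ L0 ∧ ∀ t ∈ Ico 0 T, ∀ x v : E3, f t x v ≠ 0 → Lg x v ≤ L0 := by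
  obtain ⟨B, hB0, hB⟩ := init_bdd hsol hT
  refine ⟨B ^ 2 * B ^ 2, by positivity, fun t ht x v hf => ?_⟩
  refine transport_barrier hsol hε hvanish (fun _ x v => Lg x v) (B ^ 2 * B ^ 2) ht ?_ ?_ ?_
    t ⟨ht.1, le_rfl⟩ x v hf
  · unfold Lg; fun_prop
  · intro s hs hst y w hy _ _
    have hy0 : y ≠ 0 := norm_pos_iff.1 (hε.trans hy)
    refine ⟨_, ?_, ((line_deriv y (bx lam mu s y w)).norm_sq.mul
      (line_deriv w (bv q lam mu el s y w)).norm_sq).sub ((inner_line_deriv y _ w _).pow 2)⟩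
    simp only [zero_smul, add_zero]
    have e1 : ⟪y, bv q lam mu el s y w⟫ = -(Ac q lam mu el s y w / ‖y‖) * ‖y‖ ^ 2 := by
      rw [bv, real_inner_smul_right, real_inner_self_eq_norm_sq]
    have e2 : ⟪w, bv q lam mu el s y w⟫ = -(Ac q lam mu el s y w / ‖y‖) * ⟪y, w⟫ := by
      rw [bv, real_inner_smul_right, real_inner_comm]
    have e3 : ⟪y, bx lam mu s y w⟫ = (Real.exp (mu s ‖y‖ - lam s ‖y‖) / Real.sqrt (1 + ‖w‖ ^ 2)) * ⟪y, w⟫ := by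
      rw [bx, real_inner_smul_right]
    have e4 : ⟪bx lam mu s y w, w⟫ = (Real.exp (mu s ‖y‖ - lam s ‖y‖) / Real.sqrt (1 + ‖w‖ ^ 2)) * ‖w‖ ^ 2 := by
      rw [bx, real_inner_smul_left, real_inner_self_eq_norm_sq]
    rw [e1, e2, e3, e4]
    apply le_of_eq
    push_cast
    ring
  · intro y w h
    obtain ⟨h1, h2⟩ := hB y w h
    have : ‖y‖ ^ 2 * ‖w‖ ^ 2 ≤ B ^ 2 * B ^ 2 := by gcongr
    simp only [Lg]
    nlinarith [sq_nonneg ⟪y, w⟫]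

lemma v_bdd_local (hsol : IsRegularSolutionEVM q T f lam mu el) (hT : 0 < T) {ε : ℝ} (hε : 0 < ε)
    (hvanish : ∀ t, 0 ≤ t → t < T → ∀ x v : E3, ‖x‖ ≤ ε → f t x v = 0) {t1 : ℝ}
    (ht1 : t1 ∈ Ico 0 T) :
    ∃ V, 0 ≤ V ∧ ∀ t ∈ Icc 0 t1, ∀ x v : E3, f t x v ≠ 0 → 1 + ‖v‖ ^ 2 ≤ V := by
  obtain ⟨B, hB0, hB⟩ := init_bdd hsol hT
  obtain ⟨R, hR0, hR⟩ := x_bdd hsol hT hε hvanish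
  obtain ⟨C, hC0, hC⟩ := bv_bound hsol hε ht1.2 R
  refine ⟨(1 + B ^ 2) * Real.exp (2 * C * t1), by positivity, fun t ht x v hf => ?_⟩
  have := transport_barrier hsol hε hvanish
    (fun t _ v => (1 + ‖v‖ ^ 2) * Real.exp (-(2 * C) * t)) (1 + B ^ 2) ht1 ?_ ?_ ?_ t ht x v hf
  · have h1 : 1 + ‖v‖ ^ 2 = (1 + ‖v‖ ^ 2) * Real.exp (-(2 * C) * t) * Real.exp (2 * C * t) := by
      rw [mul_assoc, ← Real.exp_add, show -(2 * C) * t + 2 * C * t = 0 by ring, Real.exp_zero, mul_one]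
    rw [h1]
    have := ht.2
    gcongr
  · fun_prop
  · intro s hs hst y w hy hfy _
    refine ⟨_, ?_, (((line_deriv w (bv q lam mu el s y w)).norm_sq.const_add 1).mul
      ((time_deriv s).const_mul (-(2 * C))).exp)⟩
    simp only [zero_smul, add_zero]
    have hb := (abs_le.1 (hC s ⟨hs.le, hst⟩ y w hy.le
      (hR s ⟨hs.le, hst.trans_lt ht1.2⟩ y w hfy))).2
    have he := Real.exp_pos (-(2 * C) * s)
    nlinarith
  · intro y w h
    have := (hB y w h).2
    simp only [mul_zero, Real.exp_zero, mul_one]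
    gcongr

end apriori

/-! ### Bounds for the moments of `f` -/

lemma box_int {g : E3 → ℝ} (hg : Integrable g) {h : ℝ → ℝ} (hh : Continuous h) {S l : ℝ}
    (hS : 0 ≤ S) (hl : 0 ≤ l)
    (h1 : ∀ v, |v 0| ≤ S → |v 1| ≤ l → |v 2| ≤ l → g v ≤ h (v 0))
    (h2 : ∀ v, ¬ (|v 0| ≤ S ∧ |v 1| ≤ l ∧ |v 2| ≤ l) → g v ≤ 0) :
    ∫ v, g v ≤ (∫ s in (-S)..S, h s) * (2 * l) ^ 2 := by
  let G : Fin 3 → ℝ → ℝ := ![(Icc (-S) S).indicator h, (Icc (-l) l).indicator 1,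
    (Icc (-l) l).indicator 1]
  have hGi : ∀ i, Integrable (G i) := by
    intro i
    fin_cases i
    · exact (integrable_indicator_iff measurableSet_Icc).2 hh.continuousOn.integrableOn_Icc
    · exact (integrable_indicator_iff measurableSet_Icc).2
        (continuous_one.continuousOn.integrableOn_Icc)
    · exact (integrable_indicator_iff measurableSet_Icc).2
        (continuous_one.continuousOn.integrableOn_Icc)
  have hmp := PiLp.volume_preserving_ofLp (Fin 3)
  have hemb : MeasurableEmbedding (@WithLp.ofLp 2 (Fin 3 → ℝ)) :=
    (MeasurableEquiv.toLp 2 (Fin 3 → ℝ)).symm.measurableEmbedding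
  have hI : Integrable (fun y : Fin 3 → ℝ => ∏ i, G i (y i)) := Integrable.fintype_prod hGi
  have hI2 : Integrable (fun v : E3 => ∏ i, G i (v i)) :=
    (hmp.integrable_comp_emb hemb).2 hI
  have hval : ∫ v : E3, ∏ i, G i (v i) = ∏ i, ∫ s, G i s := by
    rw [← integral_fintype_prod_volume_eq_prod]
    exact hmp.integral_comp hemb (fun y : Fin 3 → ℝ => ∏ i, G i (y i))
  have hone : ∫ s, (Icc (-l) l).indicator (1 : ℝ → ℝ) s = 2 * l := by
    rw [integral_indicator measurableSet_Icc, integral_Icc_eq_integral_Ioc,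
      ← intervalIntegral.integral_of_le (by linarith)]
    simp
    ring
  have hzero : ∫ s, (Icc (-S) S).indicator h s = ∫ s in (-S)..S, h s := by
    rw [integral_indicator measurableSet_Icc, integral_Icc_eq_integral_Ioc,
      ← intervalIntegral.integral_of_le (by linarith)]
  have hle : ∫ v, g v ≤ ∫ v : E3, ∏ i, G i (v i) := by
    refine integral_mono hg hI2 fun v => ?_
    simp only [Fin.prod_univ_three]
    simp only [G, Matrix.cons_val]
    by_cases hv : |v 0| ≤ S ∧ |v 1| ≤ l ∧ |v 2| ≤ l
    · have m0 : v 0 ∈ Icc (-S) S := abs_le.1 hv.1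
      have m1 : v 1 ∈ Icc (-l) l := abs_le.1 hv.2.1
      have m2 : v 2 ∈ Icc (-l) l := abs_le.1 hv.2.2
      rw [indicator_of_mem m0, indicator_of_mem m1, indicator_of_mem m2]
      simpa using h1 v hv.1 hv.2.1 hv.2.2
    · have hz : (Icc (-S) S).indicator h (v 0) * (Icc (-l) l).indicator 1 (v 1)
          * (Icc (-l) l).indicator (1 : ℝ → ℝ) (v 2) = 0 := by
        by_cases k0 : |v 0| ≤ S
        · by_cases k1 : |v 1| ≤ l
          · have k2 : ¬ |v 2| ≤ l := fun k => hv ⟨k0, k1, k⟩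
            rw [indicator_of_notMem (fun hm => k2 (abs_le.2 hm)) (f := (1 : ℝ → ℝ)) (a := v 2),
              mul_zero]
          · rw [indicator_of_notMem (fun hm => k1 (abs_le.2 hm)) (f := (1 : ℝ → ℝ)) (a := v 1),
              mul_zero, zero_mul]
        · rw [indicator_of_notMem (fun hm => k0 (abs_le.2 hm)) (f := h) (a := v 0),
              zero_mul, zero_mul]
      rw [hz]
      exact h2 v hv
  refine hle.trans (le_of_eq ?_)
  rw [hval]
  simp only [Fin.prod_univ_three]
  simp only [G, Matrix.cons_val]
  rw [hone, hzero]
  ring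

lemma arsinh_int (S : ℝ) : ∫ s in (-S)..S, (Real.sqrt (1 + s ^ 2))⁻¹ = 2 * Real.arsinh S := by
  rw [intervalIntegral.integral_eq_sub_of_hasDerivAt (fun x _ => Real.hasDerivAt_arsinh x)]
  · rw [Real.arsinh_neg]; ring
  · apply Continuous.intervalIntegrable
    exact (by fun_prop : Continuous fun s : ℝ => Real.sqrt (1 + s ^ 2)).inv₀
      (fun s => (Real.sqrt_pos.2 (by positivity)).ne')

lemma arsinh_le {Z : ℝ} (hZ : 1 ≤ Z) : Real.arsinh (Real.sqrt Z) ≤ 2 + Real.log Z := by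
  have h1 : Real.sqrt Z ≤ Z := by
    rw [Real.sqrt_le_left (by linarith)]; nlinarith
  have h2 : Real.sqrt (1 + Z) ≤ 2 * Z := by
    rw [Real.sqrt_le_left (by linarith)]; nlinarith
  have h3 : 0 < Real.sqrt Z := Real.sqrt_pos.2 (by linarith)
  rw [Real.arsinh, Real.sq_sqrt (by linarith)]
  have h4 : Real.log (Real.sqrt Z + Real.sqrt (1 + Z)) ≤ Real.log (3 * Z) :=
    Real.log_le_log (by positivity) (by linarith)
  rw [Real.log_mul (by norm_num) (by linarith)] at h4
  have h5 : Real.log 3 ≤ 3 - 1 := Real.log_le_sub_one_of_pos (by norm_num)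
  linarith

lemma w_e0 {r : ℝ} (hr : 0 < r) (v : E3) : ⟪e0 r, v⟫ / ‖e0 r‖ = v 0 := by
  rw [norm_e0 hr, e0, EuclideanSpace.inner_single_left]
  simp
  field_simp

lemma normsq3 (v : E3) : ‖v‖ ^ 2 = v 0 ^ 2 + v 1 ^ 2 + v 2 ^ 2 := by
  rw [PiLp.norm_sq_eq_of_L2, Fin.sum_univ_three]
  simp

lemma Lg_e0 {r : ℝ} (hr : 0 < r) (v : E3) : Lg (e0 r) v = r ^ 2 * (v 1 ^ 2 + v 2 ^ 2) := by
  have h := w_e0 hr v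
  rw [norm_e0 hr, div_eq_iff hr.ne'] at h
  rw [Lg, h, norm_e0 hr, normsq3]
  ring

section moments

variable {q T : ℝ} {f : ℝ → E3 → E3 → ℝ} {lam mu el : ℝ → ℝ → ℝ}

lemma trans_bdd {ε L0 r : ℝ} (hε : 0 < ε) (hr : ε ≤ r) {v : E3}
    (hL : Lg (e0 r) v ≤ L0) : v 1 ^ 2 + v 2 ^ 2 ≤ L0 / ε ^ 2 := by
  rw [Lg_e0 (hε.trans_le hr)] at hL
  rw [le_div_iff₀ (by positivity)]
  have : ε ^ 2 ≤ r ^ 2 := by gcongr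
  nlinarith [sq_nonneg (v 1), sq_nonneg (v 2)]

lemma moment_bounds (hsol : IsRegularSolutionEVM q T f lam mu el) {ε : ℝ} (hε : 0 < ε)
    {F L0 Z : ℝ} (hF0 : 0 ≤ F) (hL0 : 0 ≤ L0) (hZ : 1 ≤ Z) {t : ℝ} (ht : t ∈ Ico 0 T)
    (hF : ∀ x v, f t x v ≤ F) (hL : ∀ x v, f t x v ≠ 0 → Lg x v ≤ L0)
    (hsup : ∀ x v, f t x v ≠ 0 → 1 + ‖v‖ ^ 2 ≤ Z) {r : ℝ} (hr : ε ≤ r) :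
    rm f t r - pm f t r ≤ F * (1 + L0 / ε ^ 2) * (2 * (2 + Real.log Z)) * (4 * (L0 / ε ^ 2)) ∧
    pm f t r ≤ F * Z * (8 * (L0 / ε ^ 2)) := by
  have hr0 : 0 < r := hε.trans_le hr
  set l2 := L0 / ε ^ 2 with hl2
  have hl20 : 0 ≤ l2 := by positivity
  set l := Real.sqrt l2 with hl
  have hl0 : 0 ≤ l := Real.sqrt_nonneg _
  have hlsq : l ^ 2 = l2 := Real.sq_sqrt hl20
  set S := Real.sqrt Z with hSd
  have hS0 : 0 ≤ S := Real.sqrt_nonneg _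
  have hSsq : S ^ 2 = Z := Real.sq_sqrt (by linarith)
  have hfn := fun v => hsol.f_nonneg t ht (e0 r) v
  have hsuppt : ∀ v, f t (e0 r) v ≠ 0 → |v 0| ≤ S ∧ |v 1| ≤ l ∧ |v 2| ≤ l := by
    intro v hv
    have a1 := trans_bdd hε hr (hL _ _ hv)
    rw [← hl2] at a1
    have a2 := hsup _ _ hv
    rw [normsq3] at a2
    refine ⟨Real.abs_le_sqrt ?_, Real.abs_le_sqrt ?_, Real.abs_le_sqrt ?_⟩ <;>
      nlinarith [sq_nonneg (v 0), sq_nonneg (v 1), sq_nonneg (v 2)]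
  constructor
  · have i1 := fv_int hsol ht (e0 r) cont_sqrt1
    have i2 := fv_int hsol ht (e0 r) (cont_w2 (e0 r))
    rw [pm_eq, rm, ← integral_sub i1 i2]
    have hc : Continuous fun s : ℝ => F * (1 + l2) * (Real.sqrt (1 + s ^ 2))⁻¹ :=
      continuous_const.mul ((by fun_prop : Continuous fun s : ℝ => Real.sqrt (1 + s ^ 2)).inv₀
        (fun s => (Real.sqrt_pos.2 (by positivity)).ne'))
    refine (box_int (i1.sub i2) hc hS0 hl0 ?_ ?_).trans ?_
    · intro v _ _ _
      simp only [Pi.sub_apply]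
      rw [w_e0 hr0]
      by_cases hv : f t (e0 r) v = 0
      · rw [hv]; simp; positivity
      have a1 := trans_bdd hε hr (hL _ _ hv)
      rw [← hl2] at a1
      have hE := sqrt1_pos v
      have hE2 := sq_sqrt1 v
      have h3 : Real.sqrt (1 + v 0 ^ 2) ≤ Real.sqrt (1 + ‖v‖ ^ 2) := by
        apply Real.sqrt_le_sqrt
        rw [normsq3]
        nlinarith [sq_nonneg (v 0), sq_nonneg (v 1), sq_nonneg (v 2)]
      have h4 : 0 < Real.sqrt (1 + v 0 ^ 2) := Real.sqrt_pos.2 (by positivity)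
      have h5 : Real.sqrt (1 + ‖v‖ ^ 2) * f t (e0 r) v - v 0 ^ 2 / Real.sqrt (1 + ‖v‖ ^ 2)
          * f t (e0 r) v = f t (e0 r) v * (1 + (v 1 ^ 2 + v 2 ^ 2)) * (Real.sqrt (1 + ‖v‖ ^ 2))⁻¹ := by
        have : 1 + (v 1 ^ 2 + v 2 ^ 2) = Real.sqrt (1 + ‖v‖ ^ 2) ^ 2 - v 0 ^ 2 := by
          rw [hE2, normsq3]; ring
        rw [this]
        field_simp
      rw [h5]
      have := hF (e0 r) v
      have := hfn v
      gcongr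
    · intro v hv
      have : f t (e0 r) v = 0 := by
        by_contra h
        exact hv (hsuppt v h)
      simp [this]
    · rw [intervalIntegral.integral_const_mul, arsinh_int, mul_pow, hlsq]
      have := arsinh_le hZ
      have e : (2:ℝ) ^ 2 = 4 := by norm_num
      rw [e]
      gcongr
  · rw [pm_eq]
    have i2 := fv_int hsol ht (e0 r) (cont_w2 (e0 r))
    refine (box_int i2 (continuous_const (y := F * S)) hS0 hl0 ?_ ?_).trans ?_
    · intro v _ _ _
      rw [w_e0 hr0]
      by_cases hv : f t (e0 r) v = 0
      · rw [hv]; simp; positivity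
      have hE := sqrt1_pos v
      have hE2 := sq_sqrt1 v
      have hES : Real.sqrt (1 + ‖v‖ ^ 2) ≤ S := Real.sqrt_le_sqrt (hsup _ _ hv)
      have h1 : v 0 ^ 2 / Real.sqrt (1 + ‖v‖ ^ 2) ≤ S := by
        rw [div_le_iff₀ hE]
        have : v 0 ^ 2 ≤ Real.sqrt (1 + ‖v‖ ^ 2) ^ 2 := by
          rw [hE2, normsq3]; nlinarith [sq_nonneg (v 0), sq_nonneg (v 1), sq_nonneg (v 2)]
        nlinarith
      rw [mul_comm]
      have := hF (e0 r) v
      have := hfn v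
      gcongr
    · intro v hv
      have : f t (e0 r) v = 0 := by
        by_contra h
        exact hv (hsuppt v h)
      simp [this]
    · rw [intervalIntegral.integral_const, mul_pow, hlsq, smul_eq_mul, ← hSsq]
      apply le_of_eq
      ring

end moments

/-! ### The growth of the radial momentum -/

set_option maxHeartbeats 1000000 in
lemma alg_bound {G Gm b a n r R ε w E m ρ p P Pm u U l2 : ℝ} (hε : 0 < ε) (hr : ε ≤ r) (hrR : r ≤ R)
    (hG : 1 ≤ G) (hGm : G ≤ Gm) (hb : 0 ≤ b) (hb1 : b ≤ 1) (ha : 0 ≤ a) (ha1 : a ≤ 1) (hn : 0 ≤ n)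
    (hn1 : n ≤ 1 / (2 * ε)) (hE : 1 ≤ E) (hm : 0 ≤ m) (hml : m ≤ l2) (hE2 : E ^ 2 = 1 + m + w ^ 2)
    (hp : 0 ≤ p) (hpρ : p ≤ ρ) (hP : 0 ≤ P) (hPm : P ≤ Pm) (hu : |u| ≤ U) :
    2 * G * w * ((b * (4 * π * r * (ρ + P) - n)) * w ^ 2 / E + a * m / (r * E)
      - b * (4 * π * r * (p - P) + n) * E + u) ≤
    (8 * π * R * (ρ - p) + 16 * π * R * Pm * Gm + 2 * Gm / ε + 2 * Gm * l2 / ε + 2 * Gm * U)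
      * (1 + l2 + G * w ^ 2) + 8 * π * R * Gm * (1 + l2) * p := by
  have hE0 : 0 < E := by linarith
  have hr0 : 0 < r := by linarith
  have hR0 : 0 < R := by linarith
  have hπ := Real.pi_pos
  have hG0 : 0 ≤ G := by linarith
  have hGm0 : 0 ≤ Gm := by linarith
  have hU0 : 0 ≤ U := (abs_nonneg u).trans hu
  have hPm0 : 0 ≤ Pm := hP.trans hPm
  have hl2 : 0 ≤ l2 := hm.trans hml
  obtain ⟨z, rfl⟩ : ∃ z, w = z * E := ⟨w / E, by field_simp⟩
  set X := 1 + l2 + G * (z * E) ^ 2 with hX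
  have hz2 : z ^ 2 ≤ 1 := by
    have : (z * E) ^ 2 ≤ E ^ 2 := by linarith
    rw [mul_pow] at this
    by_contra h
    push Not at h
    nlinarith [sq_nonneg E]
  have hz : -1 ≤ z ∧ z ≤ 1 := by
    constructor <;> nlinarith
  have hEX : E ^ 2 ≤ X := by
    rw [hE2, hX]
    nlinarith [sq_nonneg (z * E)]
  have hwX : G * (z * E) ^ 2 ≤ X := by rw [hX]; linarith
  have hX1 : 1 ≤ X := by rw [hX]; nlinarith [sq_nonneg (z * E), mul_nonneg hG0 (sq_nonneg (z * E))]
  have hX0 : 0 ≤ X := by linarith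
  have hid : 2 * G * (z * E) * ((b * (4 * π * r * (ρ + P) - n)) * (z * E) ^ 2 / E + a * m / (r * E)
      - b * (4 * π * r * (p - P) + n) * E + u) =
      (8 * π * (b * r)) * (G * (z * (ρ * (z * E) ^ 2 - p * E ^ 2)))
      + (8 * π * (b * r * P * G)) * (z * ((z * E) ^ 2 + E ^ 2))
      + 2 * (b * n * G) * (-z * ((z * E) ^ 2 + E ^ 2))
      + 2 * (G * (a * m / r)) * z + 2 * G * ((z * E) * u) := by
    field_simp
    ring
  rw [hid]
  have hbr : b * r ≤ R := by nlinarith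
  have hbr0 : 0 ≤ b * r := by positivity
  have hzz : z * ((z * E) ^ 2 + E ^ 2) ≤ 2 * X := by
    have h1 : (z * E) ^ 2 ≤ E ^ 2 := by linarith
    have h2 : z * ((z * E) ^ 2 + E ^ 2) ≤ 1 * ((z * E) ^ 2 + E ^ 2) := by
      gcongr
      exact hz.2
    linarith
  have hzz' : -z * ((z * E) ^ 2 + E ^ 2) ≤ 2 * X := by
    have h1 : (z * E) ^ 2 ≤ E ^ 2 := by linarith
    have h2 : -z * ((z * E) ^ 2 + E ^ 2) ≤ 1 * ((z * E) ^ 2 + E ^ 2) := by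
      gcongr
      linarith [hz.1]
    linarith
  have t1 : (8 * π * (b * r)) * (G * (z * (ρ * (z * E) ^ 2 - p * E ^ 2)))
      ≤ 8 * π * R * (ρ - p) * X + 8 * π * R * Gm * (1 + l2) * p := by
    have hd : 0 ≤ ρ - p := by linarith
    have k : G * (z * (ρ * (z * E) ^ 2 - p * E ^ 2)) ≤ (ρ - p) * X + Gm * (1 + l2) * p := by
      rcases le_total 0 z with h | h
      · have k1 : z * (ρ * (z * E) ^ 2 - p * E ^ 2) ≤ (ρ - p) * (z * E) ^ 2 := by
          have : p * (z * E) ^ 2 ≤ p * E ^ 2 := by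
            apply mul_le_mul_of_nonneg_left _ hp; linarith
          have k2 : 0 ≤ (ρ - p) * (z * E) ^ 2 := by positivity
          calc z * (ρ * (z * E) ^ 2 - p * E ^ 2) ≤ z * ((ρ - p) * (z * E) ^ 2) := by
                apply mul_le_mul_of_nonneg_left _ h; linarith
            _ ≤ 1 * ((ρ - p) * (z * E) ^ 2) := by gcongr; exact hz.2
            _ = _ := one_mul _
        have k3 : G * (z * (ρ * (z * E) ^ 2 - p * E ^ 2)) ≤ G * ((ρ - p) * (z * E) ^ 2) := by gcongr
        have k4 : G * ((ρ - p) * (z * E) ^ 2) = (ρ - p) * (G * (z * E) ^ 2) := by ring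
        have k5 : (ρ - p) * (G * (z * E) ^ 2) ≤ (ρ - p) * X := by gcongr
        have k6 : 0 ≤ Gm * (1 + l2) * p := by positivity
        linarith
      · have k1 : z * (ρ * (z * E) ^ 2 - p * E ^ 2) ≤ (1 + l2) * p := by
          have e1 : z * (ρ * (z * E) ^ 2 - p * E ^ 2) = (-z) * (p * E ^ 2 - ρ * (z * E) ^ 2) := by ring
          have e2 : p * E ^ 2 - ρ * (z * E) ^ 2 ≤ p * (1 + m) := by
            have : p * (z * E) ^ 2 ≤ ρ * (z * E) ^ 2 := by gcongr
            rw [hE2]; linarith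
          rw [e1]
          calc (-z) * (p * E ^ 2 - ρ * (z * E) ^ 2) ≤ (-z) * (p * (1 + m)) := by
                apply mul_le_mul_of_nonneg_left e2; linarith
            _ ≤ 1 * (p * (1 + m)) := by gcongr; linarith
            _ ≤ (1 + l2) * p := by nlinarith
        have k3 : G * (z * (ρ * (z * E) ^ 2 - p * E ^ 2)) ≤ G * ((1 + l2) * p) := by gcongr
        have k4 : G * ((1 + l2) * p) ≤ Gm * ((1 + l2) * p) := by gcongr
        have k6 : 0 ≤ (ρ - p) * X := by positivity
        linarith
    have k7 : 0 ≤ (ρ - p) * X + Gm * (1 + l2) * p := by positivity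
    calc _ ≤ (8 * π * (b * r)) * ((ρ - p) * X + Gm * (1 + l2) * p) := by gcongr
      _ ≤ (8 * π * R) * ((ρ - p) * X + Gm * (1 + l2) * p) := by gcongr
      _ = _ := by ring
  have t2 : (8 * π * (b * r * P * G)) * (z * ((z * E) ^ 2 + E ^ 2)) ≤ 16 * π * R * Pm * Gm * X := by
    calc _ ≤ (8 * π * (b * r * P * G)) * (2 * X) := by gcongr
      _ ≤ (8 * π * (R * Pm * Gm)) * (2 * X) := by gcongr
      _ = _ := by ring
  have t3 : 2 * (b * n * G) * (-z * ((z * E) ^ 2 + E ^ 2)) ≤ 2 * Gm / ε * X := by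
    calc _ ≤ 2 * (b * n * G) * (2 * X) := by gcongr
      _ ≤ 2 * (1 * (1 / (2 * ε)) * Gm) * (2 * X) := by gcongr
      _ = _ := by field_simp
  have t4 : 2 * (G * (a * m / r)) * z ≤ 2 * Gm * l2 / ε * X := by
    calc _ ≤ 2 * (G * (a * m / r)) * X := by gcongr; linarith
      _ ≤ 2 * (Gm * (1 * l2 / ε)) * X := by gcongr
      _ = _ := by ring
  have t5 : 2 * G * ((z * E) * u) ≤ 2 * Gm * U * X := by
    have k1 : (z * E) * u ≤ X * U := by
      refine (le_abs_self _).trans ?_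
      rw [abs_mul]
      gcongr
      rw [abs_mul, abs_of_pos hE0]
      have : |z| ≤ 1 := abs_le.2 hz
      nlinarith
    calc _ ≤ 2 * G * (X * U) := by gcongr
      _ ≤ 2 * Gm * (X * U) := by gcongr
      _ = _ := by ring
  linarith

/-- The controlled radial momentum quantity. -/
def Xf (A0 : ℝ) (lam : ℝ → ℝ → ℝ) (t : ℝ) (x v : E3) : ℝ :=
  A0 + Real.exp (2 * lam t ‖x‖) * (⟪x, v⟫ / ‖x‖) ^ 2

section growth

variable {q T : ℝ} {f : ℝ → E3 → E3 → ℝ} {lam mu el : ℝ → ℝ → ℝ}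

lemma Xf_deriv (hsol : IsRegularSolutionEVM q T f lam mu el) {t : ℝ} (ht : t ∈ Ioo 0 T) (A0 : ℝ)
    {x : E3} (hx : x ≠ 0) (v : E3) :
    HasDerivAt (fun h : ℝ => Xf A0 lam (t + h) (x + h • bx lam mu t x v)
      (v + h • bv q lam mu el t x v))
      (2 * Real.exp (2 * lam t ‖x‖) * (⟪x, v⟫ / ‖x‖) *
        (Real.exp (mu t ‖x‖ - lam t ‖x‖) * deriv (lam t) ‖x‖ * (⟪x, v⟫ / ‖x‖) ^ 2
            / Real.sqrt (1 + ‖v‖ ^ 2)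
          + Real.exp (mu t ‖x‖ - lam t ‖x‖) * (‖v‖ ^ 2 - (⟪x, v⟫ / ‖x‖) ^ 2)
            / (‖x‖ * Real.sqrt (1 + ‖v‖ ^ 2))
          - Real.exp (mu t ‖x‖ - lam t ‖x‖) * deriv (mu t) ‖x‖ * Real.sqrt (1 + ‖v‖ ^ 2)
          + q * Real.exp (lam t ‖x‖ + mu t ‖x‖) * el t ‖x‖)) 0 := by
  have hr : 0 < ‖x‖ := norm_pos_iff.2 hx
  have hE := sqrt1_pos v
  have h1 := norm_line_deriv hx (bx lam mu t x v)
  have h2 := inner_line_deriv x (bx lam mu t x v) v (bv q lam mu el t x v)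
  have h3 := lam_chain hsol ht (a := fun h => t + h) (b := fun h : ℝ => ‖x + h • bx lam mu t x v‖)
    (r := ‖x‖) (by simp) (by simp) (time_deriv t) h1
  have h4 := (((h3.const_mul 2).exp).mul ((h2.div h1 (by simpa using hx)).pow 2)).const_add A0
  refine h4.congr_deriv ?_
  simp only [zero_smul, add_zero, Pi.div_apply, Pi.pow_apply, Nat.cast_ofNat,
    show (2 - 1 : ℕ) = 1 from rfl, pow_one]
  have e1 : ⟪x, bv q lam mu el t x v⟫ = -(Ac q lam mu el t x v / ‖x‖) * ‖x‖ ^ 2 := by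
    rw [bv, real_inner_smul_right, real_inner_self_eq_norm_sq]
  have e3 : ⟪x, bx lam mu t x v⟫ = (Real.exp (mu t ‖x‖ - lam t ‖x‖) / Real.sqrt (1 + ‖v‖ ^ 2)) * ⟪x, v⟫ := by
    rw [bx, real_inner_smul_right]
  have e4 : ⟪bx lam mu t x v, v⟫ = (Real.exp (mu t ‖x‖ - lam t ‖x‖) / Real.sqrt (1 + ‖v‖ ^ 2)) * ‖v‖ ^ 2 := by
    rw [bx, real_inner_smul_left, real_inner_self_eq_norm_sq]
  rw [e1, e3, e4, Ac]
  generalize Real.exp (mu t ‖x‖ - lam t ‖x‖) = a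
  generalize Real.exp (lam t ‖x‖ + mu t ‖x‖) = b
  generalize Real.exp (2 * lam t ‖x‖) = G
  generalize Real.sqrt (1 + ‖v‖ ^ 2) = E at *
  generalize deriv (fun s => lam s ‖x‖) t = ld
  generalize deriv (lam t) ‖x‖ = l'
  generalize deriv (mu t) ‖x‖ = m'
  generalize ⟪x, v⟫ = s
  generalize ‖x‖ = r at *
  generalize ‖v‖ = nv
  field_simp
  ring

end growth

section conclusion

variable {q T : ℝ} {f : ℝ → E3 → E3 → ℝ} {lam mu el : ℝ → ℝ → ℝ}

lemma Lg_div {x : E3} (hx : x ≠ 0) (v : E3) :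
    ‖v‖ ^ 2 - (⟪x, v⟫ / ‖x‖) ^ 2 = Lg x v / ‖x‖ ^ 2 := by
  have hr : 0 < ‖x‖ := norm_pos_iff.2 hx
  rw [Lg]
  field_simp

set_option maxHeartbeats 2000000 in
lemma X_growth (hsol : IsRegularSolutionEVM q T f lam mu el) (hT : 0 < T) {ε : ℝ} (hε : 0 < ε)
    (hvanish : ∀ t, 0 ≤ t → t < T → ∀ x v : E3, ‖x‖ ≤ ε → f t x v = 0) :
    ∃ A0 C Gm : ℝ, 0 ≤ A0 ∧ 0 ≤ C ∧ 0 ≤ Gm ∧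
      (∀ t ∈ Ico 0 T, ∀ x v : E3, f t x v ≠ 0 →
        1 + ‖v‖ ^ 2 ≤ Xf A0 lam t x v ∧ Xf A0 lam t x v ≤ A0 + Gm * (1 + ‖v‖ ^ 2)) ∧
      ∀ t ∈ Ioo 0 T, ∀ Z, 1 ≤ Z → (∀ x v : E3, f t x v ≠ 0 → Xf A0 lam t x v ≤ Z) →
        ∀ x v : E3, f t x v ≠ 0 → ∃ D ≤ C * (1 + Real.log Z) * Z,
          HasDerivAt (fun h : ℝ => Xf A0 lam (t + h) (x + h • bx lam mu t x v)
            (v + h • bv q lam mu el t x v)) D 0 := by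
  obtain ⟨F, hF0, hF⟩ := f_bdd hsol hT hε hvanish
  obtain ⟨R, hR0, hR⟩ := x_bdd hsol hT hε hvanish
  obtain ⟨L0, hL00, hL0⟩ := Lg_bdd hsol hT hε hvanish
  obtain ⟨Lm, hLm⟩ := lam_bdd hsol hT hε
  set l2 := L0 / ε ^ 2 with hl2
  have hl20 : 0 ≤ l2 := by positivity
  set Gm := Real.exp (2 * Lm) with hGm
  have hGm0 : 0 < Gm := Real.exp_pos _
  set K := |q| * Real.exp Lm / (8 * π) / ε with hK
  have hπ := Real.pi_pos
  have hK0 : 0 ≤ K := by positivity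
  set c1 := F * (1 + l2) * 2 * (4 * l2) with hc1
  have hc10 : 0 ≤ c1 := by positivity
  set c2 := F * (8 * l2) with hc2
  have hc20 : 0 ≤ c2 := by positivity
  set c3 := 16 * π * R * (1 / 2 * K ^ 2) * Gm + 2 * Gm / ε + 2 * Gm * l2 / ε + 2 * Gm * (|q| * K) with hc3
  have hc30 : 0 ≤ c3 := by positivity
  have hxε : ∀ t ∈ Ico 0 T, ∀ x v : E3, f t x v ≠ 0 → ε < ‖x‖ := by
    intro t ht x v hf
    by_contra h
    exact hf (hvanish t ht.1 ht.2 x v (not_lt.1 h))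
  have hm : ∀ t ∈ Ico 0 T, ∀ x v : E3, f t x v ≠ 0 → 0 ≤ ‖v‖ ^ 2 - (⟪x, v⟫ / ‖x‖) ^ 2 ∧
      ‖v‖ ^ 2 - (⟪x, v⟫ / ‖x‖) ^ 2 ≤ l2 := by
    intro t ht x v hf
    have hx := hxε t ht x v hf
    refine ⟨by linarith [sq_w_le x v], ?_⟩
    rw [Lg_div (norm_pos_iff.1 (hε.trans hx)), hl2]
    have := hL0 t ht x v hf
    gcongr
  have hG : ∀ t ∈ Ico 0 T, ∀ x v : E3, f t x v ≠ 0 → 1 ≤ Real.exp (2 * lam t ‖x‖) ∧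
      Real.exp (2 * lam t ‖x‖) ≤ Gm := by
    intro t ht x v hf
    have hx := hxε t ht x v hf
    have h1 := lam_nonneg hsol ht (hε.trans hx)
    have h2 := hLm t ht ‖x‖ hx.le
    exact ⟨Real.one_le_exp (by linarith), Real.exp_le_exp.2 (by linarith)⟩
  have hXE : ∀ t ∈ Ico 0 T, ∀ x v : E3, f t x v ≠ 0 → 1 + ‖v‖ ^ 2 ≤ Xf (1 + l2) lam t x v := by
    intro t ht x v hf
    have h1 := (hm t ht x v hf).2
    have h2 := (hG t ht x v hf).1
    rw [Xf]
    nlinarith [sq_nonneg (⟪x, v⟫ / ‖x‖)]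
  refine ⟨1 + l2, 8 * π * R * (2 * c1) + c3 + 8 * π * R * Gm * (1 + l2) * c2, Gm, by positivity,
    by positivity, hGm0.le, ?_, ?_⟩
  · intro t ht x v hf
    refine ⟨hXE t ht x v hf, ?_⟩
    have h1 := sq_w_le x v
    have h2 := (hG t ht x v hf).2
    rw [Xf]
    gcongr
    linarith
  · intro t ht Z hZ hXZ x v hf
    have htI : t ∈ Ico 0 T := ⟨ht.1.le, ht.2⟩
    have hx := hxε t htI x v hf
    have hr0 : 0 < ‖x‖ := hε.trans hx
    have hx0 : x ≠ 0 := norm_pos_iff.1 hr0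
    refine ⟨_, ?_, Xf_deriv hsol ht (1 + l2) hx0 v⟩
    obtain ⟨mb1, mb2⟩ := moment_bounds hsol hε hF0 hL00 hZ htI (hF t htI) (hL0 t htI)
      (fun y w h => (hXE t htI y w h).trans (hXZ y w h)) hx.le
    rw [← hl2] at mb1 mb2
    have hl := lam_eq hsol htI hr0
    have hmu := mu_eq hsol htI hr0
    have ha : Real.exp (mu t ‖x‖ - lam t ‖x‖)
        = Real.exp (lam t ‖x‖ + mu t ‖x‖) * Real.exp (-2 * lam t ‖x‖) := by
      rw [← Real.exp_add]; ring_nf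
    have hel := el_bound hsol htI (hvanish t ht.1.le ht.2) (fun r _ h => hLm t htI r h) hr0
    have hel2 : Real.exp (lam t ‖x‖) * |el t ‖x‖| ≤ K := by
      refine hel.trans ?_
      rw [hK]
      gcongr
    have hP : 1 / 2 * Real.exp (2 * lam t ‖x‖) * el t ‖x‖ ^ 2 ≤ 1 / 2 * K ^ 2 := by
      have : Real.exp (2 * lam t ‖x‖) * el t ‖x‖ ^ 2 = (Real.exp (lam t ‖x‖) * |el t ‖x‖|) ^ 2 := by
        rw [mul_pow, sq_abs, ← Real.exp_nat_mul]
        norm_num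
      rw [mul_assoc, this]
      gcongr
    have hu : |q * Real.exp (lam t ‖x‖ + mu t ‖x‖) * el t ‖x‖| ≤ |q| * K := by
      have h1 := mu_nonpos hsol htI hr0
      have h2 : Real.exp (mu t ‖x‖) ≤ 1 := Real.exp_le_one_iff.2 h1
      rw [abs_mul, abs_mul, Real.abs_exp, Real.exp_add, mul_assoc]
      gcongr
      calc _ = Real.exp (mu t ‖x‖) * (Real.exp (lam t ‖x‖) * |el t ‖x‖|) := by ring
        _ ≤ 1 * K := by gcongr
        _ = K := one_mul _
    obtain ⟨n0, n1⟩ := n_bound hsol htI hr0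
    have n2 : 1 / (2 * ‖x‖) ≤ 1 / (2 * ε) := by gcongr
    have hb1 : Real.exp (lam t ‖x‖ + mu t ‖x‖) ≤ 1 :=
      Real.exp_le_one_iff.2 (lam_add_mu_nonpos hsol htI hr0)
    have hE2 := sq_sqrt1 v
    have key := alg_bound (U := |q| * K) (u := q * Real.exp (lam t ‖x‖ + mu t ‖x‖) * el t ‖x‖)
      (Gm := Gm) (R := R) (Pm := 1 / 2 * K ^ 2) (w := ⟪x, v⟫ / ‖x‖) (E := Real.sqrt (1 + ‖v‖ ^ 2))
      (m := ‖v‖ ^ 2 - (⟪x, v⟫ / ‖x‖) ^ 2) (ρ := rm f t ‖x‖) (p := pm f t ‖x‖) hε hx.le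
      (hR t htI x v hf) (hG t htI x v hf).1 (hG t htI x v hf).2
      (Real.exp_pos (lam t ‖x‖ + mu t ‖x‖)).le hb1
      (Real.exp_pos (mu t ‖x‖ - lam t ‖x‖)).le (exp_mu_lam_le_one hsol htI hr0) n0 (n1.trans n2)
      (one_le_sqrt1 v) (hm t htI x v hf).1 (hm t htI x v hf).2 (by rw [hE2]; ring)
      (pm_nonneg hsol htI _) (pm_le_rm hsol htI _) (by positivity) hP hu
    rw [← hl, ← hmu] at key
    rw [← mul_assoc (Real.exp (lam t ‖x‖ + mu t ‖x‖)), ← mul_assoc (Real.exp (lam t ‖x‖ + mu t ‖x‖)),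
      ← ha] at key
    refine key.trans ?_
    have hX := hXZ x v hf
    rw [Xf] at hX
    set X := 1 + l2 + Real.exp (2 * lam t ‖x‖) * (⟪x, v⟫ / ‖x‖) ^ 2 with hXd
    have hX0 : 0 ≤ X := by positivity
    have hlog : 0 ≤ Real.log Z := Real.log_nonneg hZ
    have hZ0 : 0 ≤ Z := by linarith
    have hd : 0 ≤ rm f t ‖x‖ - pm f t ‖x‖ := by linarith [pm_le_rm hsol htI (f := f) ‖x‖]
    have k1 : rm f t ‖x‖ - pm f t ‖x‖ ≤ 2 * c1 * (1 + Real.log Z) := by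
      have : c1 * (2 + Real.log Z) ≤ 2 * c1 * (1 + Real.log Z) := by nlinarith
      refine le_trans (le_of_le_of_eq mb1 ?_) this
      rw [hc1]; ring
    have k2 : pm f t ‖x‖ ≤ c2 * (1 + Real.log Z) * Z := by
      have e1 : F * Z * (8 * l2) = c2 * 1 * Z := by rw [hc2]; ring
      rw [e1] at mb2
      refine mb2.trans ?_
      gcongr
      linarith
    have k3 : c3 ≤ c3 * (1 + Real.log Z) := by nlinarith
    have k4 : 8 * π * R * (rm f t ‖x‖ - pm f t ‖x‖) + c3
        ≤ 8 * π * R * (2 * c1 * (1 + Real.log Z)) + c3 * (1 + Real.log Z) := by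
      gcongr
    have k5 : (8 * π * R * (rm f t ‖x‖ - pm f t ‖x‖) + c3) * X
        ≤ (8 * π * R * (2 * c1 * (1 + Real.log Z)) + c3 * (1 + Real.log Z)) * Z := by
      gcongr
    have k6 : 8 * π * R * Gm * (1 + l2) * pm f t ‖x‖
        ≤ 8 * π * R * Gm * (1 + l2) * (c2 * (1 + Real.log Z) * Z) := by gcongr
    have e : (8 * π * R * (rm f t ‖x‖ - pm f t ‖x‖) + 16 * π * R * (1 / 2 * K ^ 2) * Gm
      + 2 * Gm / ε + 2 * Gm * l2 / ε + 2 * Gm * (|q| * K)) =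
      8 * π * R * (rm f t ‖x‖ - pm f t ‖x‖) + c3 := by rw [hc3]; ring
    rw [e]
    linarith

lemma Xf_cont (hsol : IsRegularSolutionEVM q T f lam mu el) {ε : ℝ} (hε : 0 < ε) {t1 : ℝ}
    (ht1 : t1 ∈ Ico 0 T) (A0 : ℝ) :
    ContinuousOn (fun p : ℝ × E3 × E3 => Xf A0 lam p.1 p.2.1 p.2.2)
      (Icc 0 t1 ×ˢ ({x | ε ≤ ‖x‖} ×ˢ univ)) := by
  have h1 : ContinuousOn (fun p : ℝ × E3 × E3 => lam p.1 ‖p.2.1‖)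
      (Icc 0 t1 ×ˢ ({x | ε ≤ ‖x‖} ×ˢ univ)) :=
    hsol.lam_c1.continuousOn.comp (f := fun p : ℝ × E3 × E3 => (p.1, ‖p.2.1‖)) (by fun_prop)
      (fun p hp => ⟨⟨hp.1.1, hp.1.2.trans_lt ht1.2⟩, mem_univ _⟩)
  have h2 : ContinuousOn (fun p : ℝ × E3 × E3 => ⟪p.2.1, p.2.2⟫ / ‖p.2.1‖)
      (Icc 0 t1 ×ˢ ({x | ε ≤ ‖x‖} ×ˢ univ)) := by
    refine ContinuousOn.div (by fun_prop) (by fun_prop) (fun p hp => ?_)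
    exact (hε.trans_le hp.2.1).ne'
  unfold Xf
  exact continuousOn_const.add ((Real.continuous_exp.comp_continuousOn (h1.const_mul 2)).mul (h2.pow 2))

lemma v_bdd_global (hsol : IsRegularSolutionEVM q T f lam mu el) (hT : 0 < T) {ε : ℝ} (hε : 0 < ε)
    (hvanish : ∀ t, 0 ≤ t → t < T → ∀ x v : E3, ‖x‖ ≤ ε → f t x v = 0) :
    ∃ V, ∀ t ∈ Ico 0 T, ∀ x v : E3, f t x v ≠ 0 → 1 + ‖v‖ ^ 2 ≤ V := by
  obtain ⟨A0, C, Gm, hA0, hC0, hGm0, hXb, hgr⟩ := X_growth hsol hT hε hvanish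
  obtain ⟨V0, hV00, hV0⟩ := v_bdd_local hsol hT hε hvanish (t1 := 0) ⟨le_rfl, hT⟩
  set X0 := A0 + Gm * V0 + 1 with hX0
  have hX01 : 1 ≤ X0 := by rw [hX0]; nlinarith [mul_nonneg hGm0 hV00]
  set κ := 4 * C with hκ
  have hκ0 : 0 ≤ κ := by positivity
  set Y0 := Real.log (4 * X0) + 1 with hY0
  have hlogX : 0 ≤ Real.log (4 * X0) := Real.log_nonneg (by linarith)
  have hY01 : 1 ≤ Y0 := by rw [hY0]; linarith
  set c0 := Real.log (4 / 3) * Real.exp (-(κ * T)) with hc0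
  have hl43 : 0 < Real.log (4 / 3) := Real.log_pos (by norm_num)
  have hc0pos : 0 < c0 := by positivity
  refine ⟨Real.exp (Y0 * Real.exp (κ * T)), fun t1 ht1 => ?_⟩
  have hstep : ∀ Y, Y0 ≤ Y →
      (∀ s ∈ Icc 0 t1, ∀ x v : E3, f s x v ≠ 0 → Xf A0 lam s x v ≤ Real.exp (Y * Real.exp (κ * s))) →
      (∀ s ∈ Icc 0 t1, ∀ x v : E3, f s x v ≠ 0 →
        Xf A0 lam s x v ≤ Real.exp ((Y - c0) * Real.exp (κ * s))) := by
    intro Y hY hbd s hs x v hf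
    have hYe : ∀ s : ℝ, 0 ≤ s → Y ≤ Y * Real.exp (κ * s) := fun s hs =>
      le_mul_of_one_le_right (by linarith) (Real.one_le_exp (by positivity))
    have hb := transport_barrier hsol hε hvanish
      (fun s x v => Xf A0 lam s x v - 1 / 2 * Real.exp (Y * Real.exp (κ * s))) X0 ht1 ?_ ?_ ?_
      s hs x v hf
    · set Z := Real.exp (Y * Real.exp (κ * s)) with hZ
      have hZ4 : 4 * X0 ≤ Z := by
        rw [← Real.exp_log (by linarith : 0 < 4 * X0), hZ]
        apply Real.exp_le_exp.2
        have := hYe s hs.1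
        linarith
      have hsT : s ≤ T := hs.2.trans ht1.2.le
      have h1 : c0 * Real.exp (κ * s) ≤ Real.log (4 / 3) := by
        rw [hc0, mul_assoc, ← Real.exp_add]
        have : Real.exp (-(κ * T) + κ * s) ≤ 1 := Real.exp_le_one_iff.2 (by nlinarith)
        nlinarith
      have h2 : Real.exp ((Y - c0) * Real.exp (κ * s)) = Z * Real.exp (-(c0 * Real.exp (κ * s))) := by
        rw [hZ, ← Real.exp_add]; ring_nf
      have h3 : (3 / 4 : ℝ) ≤ Real.exp (-(c0 * Real.exp (κ * s))) := by
        have : (3 / 4 : ℝ) = Real.exp (-Real.log (4 / 3)) := by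
          rw [Real.exp_neg, Real.exp_log (by norm_num)]; norm_num
        rw [this]
        exact Real.exp_le_exp.2 (by linarith)
      have hZ0 : 0 < Z := Real.exp_pos _
      rw [h2]
      nlinarith
    · refine (Xf_cont hsol hε ht1 A0).sub ?_
      fun_prop
    · intro t ht htt y w hy hfy _
      have htI : t ∈ Ioo 0 T := ⟨ht, htt.trans_lt ht1.2⟩
      have hlog1 : 1 ≤ Y * Real.exp (κ * t) := by linarith [hYe t ht.le]
      obtain ⟨D, hD, hder⟩ := hgr t htI (Real.exp (Y * Real.exp (κ * t)))
        (Real.one_le_exp (by linarith)) (hbd t ⟨ht.le, htt⟩) y w hfy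
      refine ⟨_, ?_, hder.sub (((((time_deriv t).const_mul κ).exp.const_mul Y).exp).const_mul (1 / 2))⟩
      simp only [add_zero]
      rw [Real.log_exp] at hD
      set Z := Real.exp (Y * Real.exp (κ * t)) with hZ
      have hZ0 : 0 < Z := Real.exp_pos _
      set g := Y * Real.exp (κ * t) with hg
      have e : 1 / 2 * (Z * (Y * (Real.exp (κ * t) * (κ * 1)))) = 2 * (C * Z) * g := by
        rw [hg, hκ]; ring
      rw [e]
      have : 0 ≤ C * Z := by positivity
      nlinarith
    · intro y w hfy
      have h1 := (hXb 0 ⟨le_rfl, hT⟩ y w hfy).2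
      have h2 := hV0 0 ⟨le_rfl, le_rfl⟩ y w hfy
      have h3 : Gm * (1 + ‖w‖ ^ 2) ≤ Gm * V0 := by gcongr
      have h4 := Real.exp_pos (Y * Real.exp (κ * 0))
      rw [hX0]
      linarith
  have hdesc : ∀ n : ℕ, (∀ s ∈ Icc 0 t1, ∀ x v : E3, f s x v ≠ 0 →
        Xf A0 lam s x v ≤ Real.exp ((Y0 + n * c0) * Real.exp (κ * s))) →
      (∀ s ∈ Icc 0 t1, ∀ x v : E3, f s x v ≠ 0 →
        Xf A0 lam s x v ≤ Real.exp (Y0 * Real.exp (κ * s))) := by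
    intro n
    induction n with
    | zero => intro h; simpa using h
    | succ n ih =>
      intro h
      apply ih
      have h2 := hstep (Y0 + ((n + 1 : ℕ) : ℝ) * c0) (by
        have : 0 ≤ ((n + 1 : ℕ) : ℝ) * c0 := by positivity
        linarith) h
      have e : Y0 + ((n + 1 : ℕ) : ℝ) * c0 - c0 = Y0 + (n : ℝ) * c0 := by push_cast; ring
      rw [e] at h2
      exact h2
  obtain ⟨V, hV0', hV⟩ := v_bdd_local hsol hT hε hvanish ht1
  obtain ⟨n, hn⟩ := exists_nat_ge ((A0 + Gm * V) / c0)
  rw [div_le_iff₀ hc0pos] at hn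
  have hstart : ∀ s ∈ Icc 0 t1, ∀ x v : E3, f s x v ≠ 0 →
        Xf A0 lam s x v ≤ Real.exp ((Y0 + n * c0) * Real.exp (κ * s)) := by
    intro s hs x v hf
    have h1 := (hXb s ⟨hs.1, hs.2.trans_lt ht1.2⟩ x v hf).2
    have h2 := hV s hs x v hf
    have h3 : Gm * (1 + ‖v‖ ^ 2) ≤ Gm * V := by gcongr
    have h4 : 0 ≤ (n : ℝ) * c0 := by positivity
    have h5 : Y0 + n * c0 ≤ (Y0 + n * c0) * Real.exp (κ * s) :=
      le_mul_of_one_le_right (by linarith)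
        (Real.one_le_exp (mul_nonneg hκ0 hs.1))
    have h6 := Real.add_one_le_exp ((Y0 + n * c0) * Real.exp (κ * s))
    linarith
  intro x v hf
  have h1 := hdesc n hstart t1 ⟨ht1.1, le_rfl⟩ x v hf
  refine ((hXb t1 ht1 x v hf).1.trans h1).trans ?_
  have := ht1.2.le
  gcongr

end conclusion

lemma aux_norm {a V : ℝ} (h : 1 + a ^ 2 ≤ V) : a ≤ V := by nlinarith [sq_nonneg (a - 1)]

lemma tsub1 {g : E3 × E3 → ℝ} {V : ℝ} (h : ∀ p, g p ≠ 0 → ‖p.2‖ ≤ V) :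
    ∀ p ∈ tsupport g, ‖p.2‖ ≤ V := by
  have hcl : IsClosed {p : E3 × E3 | ‖p.2‖ ≤ V} := isClosed_le (by fun_prop) (by fun_prop)
  have : tsupport g ⊆ {p : E3 × E3 | ‖p.2‖ ≤ V} := closure_minimal (fun p hp => h p hp) hcl
  intro p hp
  exact this hp

lemma tsupport_bdd {T : ℝ} {f : ℝ → E3 → E3 → ℝ}
    (h : ∃ V, ∀ t ∈ Ico 0 T, ∀ x v : E3, f t x v ≠ 0 → 1 + ‖v‖ ^ 2 ≤ V) :
    ∃ C : ℝ, ∀ t ∈ Ico (0 : ℝ) T, ∀ x v : E3,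
      (x, v) ∈ tsupport (fun p : E3 × E3 => f t p.1 p.2) → ‖v‖ ≤ C := by
  obtain ⟨V, hV⟩ := h
  refine ⟨V, fun t ht x v hxv => ?_⟩
  exact tsub1 (g := fun p : E3 × E3 => f t p.1 p.2) (fun p hp => aux_norm (hV t ht p.1 p.2 hp)) (x, v) hxv

theorem momentum_bound_away_from_center
    (q T : ℝ) (hT : 0 < T)
    (f0 : E3 → E3 → ℝ) (lam0 mu0 el0 : ℝ → ℝ)
    (hf0 : IsInitialDatum f0) (hmass : InitialMassCondition f0)
    (hconstraint : IsConstraintSolution q f0 lam0 mu0 el0)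
    (f : ℝ → E3 → E3 → ℝ) (lam mu el : ℝ → ℝ → ℝ)
    (hsol : IsRegularSolutionEVM q T f lam mu el)
    (hinit : TakesInitialData f lam mu el f0 lam0 mu0 el0)
    (ε : ℝ) (hε : 0 < ε)
    (hvanish : ∀ t, 0 ≤ t → t < T → ∀ x v : E3, ‖x‖ ≤ ε → f t x v = 0) :
    ∃ C : ℝ, ∀ t ∈ Ico (0 : ℝ) T, ∀ x v : E3,
      (x, v) ∈ tsupport (fun p : E3 × E3 => f t p.1 p.2) → ‖v‖ ≤ C := by
  exact tsupport_bdd (v_bdd_global hsol hT hε hvanish)
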